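/- arXiv:2501.19229 — 2 statements merged into one kernel-verified Lean document; each statement's English description precedes it below -/
import Mathlib

section
/- There exist ε > 0 and N₀ such that for all n ≥ N₀: every Δ_r-free r-graph H on n vertices with δ(H) ≥ n^{r−1}/r^{r−1} − ε n^{r−1} is r-partite. Consequently, for large n, the balanced complete r-partite r-graph T^r(n) is the unique Δ_r-free r-graph on n vertices with the maximum number of edges. -/
/-- An `r`-graph `H` is `Δ_r`-free if it contains no copy of a triangle
`𝕋_{r,i}` for any `1 ≤ i ≤ ⌈r/2⌉`, where `𝕋_{r,i}` has the three edges
`{1,…,r}`, `{1,…,i} ∪ {r+1,…,2r−i}` and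
`{i+1,…,r} ∪ {r+1} ∪ {2r−i+1,…,2r−1}`. -/
def DeltaFree (r : ℕ) {V : Type*} [DecidableEq V] (H : Finset (Finset V)) : Prop :=
  ¬ ∃ i : ℕ, 1 ≤ i ∧ i ≤ (r + 1) / 2 ∧
    ∃ f : ℕ → V, Set.InjOn f (Set.Icc 1 (2 * r - 1)) ∧
      (Finset.Icc 1 r).image f ∈ H ∧
      ((Finset.Icc 1 i ∪ Finset.Icc (r + 1) (2 * r - i)).image f) ∈ H ∧
      ((Finset.Icc (i + 1) r ∪ insert (r + 1)
        (Finset.Icc (2 * r - i + 1) (2 * r - 1))).image f) ∈ H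

/-- An `r`-graph is `r`-partite if its vertices can be coloured with `r`
colours so that every edge contains exactly one vertex of each colour. -/
def RPartite (r : ℕ) {V : Type*} [DecidableEq V] [Fintype V]
    (H : Finset (Finset V)) : Prop :=
  ∃ P : V → Fin r, ∀ e ∈ H, ∀ k : Fin r, (e.filter (fun u => P u = k)).card = 1

namespace HMantel

open Finset

/-- A function realising a given bijection type between finsets of equal cardinality. -/
lemma exists_image_eq {V : Type*} [DecidableEq V] (d : V) (s : Finset ℕ) (S : Finset V)
    (h : s.card = S.card) : ∃ g : ℕ → V, s.image g = S := by
  classical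
  let e := Finset.equivOfCardEq h
  refine ⟨fun k => if hk : k ∈ s then (e ⟨k, hk⟩ : V) else d, ?_⟩
  ext v
  simp only [mem_image]
  constructor
  · rintro ⟨k, hk, rfl⟩
    simp [hk]
  · intro hv
    refine ⟨(e.symm ⟨v, hv⟩ : ℕ), (e.symm ⟨v, hv⟩).2, ?_⟩
    simp

/-- A triangle-like configuration yields a copy of `T_{r,i}`. -/
lemma mkT {r : ℕ} {V : Type*} [DecidableEq V] {H : Finset (Finset V)} (hH : DeltaFree r H)
    {A B C : Finset V} (hA : A ∈ H) (hB : B ∈ H) (hC : C ∈ H)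
    (cA : A.card = r) (cB : B.card = r) (cC : C.card = r) {z : V} (hz : z ∉ A)
    (h1 : 1 ≤ (A ∩ B).card) (h2 : (A ∩ B).card ≤ (r + 1) / 2)
    (h3 : A ∩ C = A \ B) (h4 : B ∩ C = {z}) : False := by
  classical
  apply hH
  set i := (A ∩ B).card with hi
  have hzB : z ∈ B := by
    have : z ∈ B ∩ C := by rw [h4]; simp
    exact (mem_inter.1 this).1
  have hzC : z ∈ C := by
    have : z ∈ B ∩ C := by rw [h4]; simp
    exact (mem_inter.1 this).2
  have c2 : (A \ B).card = r - i := by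
    have := card_sdiff_add_card_inter A B
    omega
  have hir : i + 1 ≤ r := by
    have hlt : (A ∩ B).card < B.card := by
      apply card_lt_card
      refine ⟨inter_subset_right, fun h => hz (mem_inter.1 (h hzB)).1⟩
    omega
  have c3 : ((B \ A).erase z).card = r - i - 1 := by
    have := card_sdiff_add_card_inter B A
    rw [inter_comm B A] at this
    rw [card_erase_of_mem (by simp [hzB, hz])]
    omega
  have c4 : ((C \ A).erase z).card = i - 1 := by
    have := card_sdiff_add_card_inter C A
    rw [inter_comm C A, h3] at this
    rw [card_erase_of_mem (by simp [hzC, hz])]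
    omega
  obtain ⟨g1, hg1⟩ := exists_image_eq z (Finset.Icc 1 i) (A ∩ B) (by simp [hi])
  obtain ⟨g2, hg2⟩ := exists_image_eq z (Finset.Icc (i+1) r) (A \ B) (by simp [c2])
  obtain ⟨g3, hg3⟩ := exists_image_eq z (Finset.Icc (r+2) (2*r-i)) ((B \ A).erase z) (by
    rw [c3, Nat.card_Icc]; omega)
  obtain ⟨g4, hg4⟩ := exists_image_eq z (Finset.Icc (2*r-i+1) (2*r-1)) ((C \ A).erase z) (by
    rw [c4, Nat.card_Icc]; omega)
  let f : ℕ → V := fun k => if k ≤ i then g1 k else if k ≤ r then g2 k else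
    if k = r + 1 then z else if k ≤ 2*r-i then g3 k else g4 k
  have f1 : (Finset.Icc 1 i).image f = A ∩ B := by
    rw [← hg1]; apply image_congr
    intro k hk
    simp only [coe_Icc, Set.mem_Icc] at hk
    simp only [f]; rw [if_pos hk.2]
  have f2 : (Finset.Icc (i+1) r).image f = A \ B := by
    rw [← hg2]; apply image_congr
    intro k hk
    simp only [coe_Icc, Set.mem_Icc] at hk
    simp only [f]; rw [if_neg (by omega), if_pos hk.2]
  have fz : f (r+1) = z := by
    simp only [f]; rw [if_neg (by omega), if_neg (by omega)]; simp
  have f3 : (Finset.Icc (r+2) (2*r-i)).image f = (B \ A).erase z := by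
    rw [← hg3]; apply image_congr
    intro k hk
    simp only [coe_Icc, Set.mem_Icc] at hk
    simp only [f]; rw [if_neg (by omega), if_neg (by omega), if_neg (by omega), if_pos hk.2]
  have f4 : (Finset.Icc (2*r-i+1) (2*r-1)).image f = (C \ A).erase z := by
    rw [← hg4]; apply image_congr
    intro k hk
    simp only [coe_Icc, Set.mem_Icc] at hk
    simp only [f]; rw [if_neg (by omega), if_neg (by omega), if_neg (by omega), if_neg (by omega)]
  have e1 : (Finset.Icc 1 r).image f = A := by
    have : Finset.Icc 1 r = Finset.Icc 1 i ∪ Finset.Icc (i+1) r := by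
      ext k; simp only [mem_Icc, mem_union]; omega
    rw [this, image_union, f1, f2]
    ext v; simp only [mem_union, mem_inter, mem_sdiff]; tauto
  have e2 : (Finset.Icc 1 i ∪ Finset.Icc (r + 1) (2 * r - i)).image f = B := by
    have : Finset.Icc (r+1) (2*r-i) = insert (r+1) (Finset.Icc (r+2) (2*r-i)) := by
      ext k; simp only [mem_Icc, mem_insert]; omega
    rw [this, image_union, f1, image_insert, fz, f3]
    ext v
    simp only [mem_union, mem_inter, mem_insert, mem_erase, mem_sdiff]
    by_cases hv : v = z
    · subst hv; tauto
    · tauto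
  have e3 : (Finset.Icc (i + 1) r ∪ insert (r + 1)
        (Finset.Icc (2 * r - i + 1) (2 * r - 1))).image f = C := by
    rw [image_union, f2, image_insert, fz, f4, ← h3]
    ext v
    simp only [mem_union, mem_inter, mem_insert, mem_erase, mem_sdiff]
    by_cases hv : v = z
    · subst hv; tauto
    · tauto
  refine ⟨i, h1, h2, f, ?_, e1 ▸ hA, e2 ▸ hB, e3 ▸ hC⟩
  have hall : (Finset.Icc 1 (2*r-1)).image f = A ∪ (B ∪ C) := by
    rw [← e1, ← e2, ← e3, ← image_union, ← image_union]
    congr 1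
    ext k; simp only [mem_Icc, mem_union, mem_insert]; omega
  have hcard : (A ∪ (B ∪ C)).card = 2 * r - 1 := by
    have hBC := card_union_add_card_inter B C
    rw [h4, card_singleton] at hBC
    have := card_union_add_card_inter A (B ∪ C)
    have hAA : A ∩ (B ∪ C) = A := by
      rw [inter_union_distrib_left, h3]
      ext v; simp only [mem_union, mem_inter, mem_sdiff]; tauto
    rw [hAA] at this
    omega
  have : Set.InjOn f (Finset.Icc 1 (2*r-1) : Finset ℕ) := by
    apply Finset.card_image_iff.1
    rw [hall, hcard, Nat.card_Icc]; omega
  simpa using this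

/-- `S` is covered by an edge. -/
def Cov {V : Type*} (G : Finset (Finset V)) (S : Finset V) : Prop := ∃ e ∈ G, S ⊆ e

/-- Robustness: covered sets have extensions avoiding any small set. -/
def Robust {V : Type*} (r : ℕ) (G : Finset (Finset V)) : Prop :=
  ∀ S F : Finset V, Cov G S → F.card ≤ 2 * r → Disjoint S F → ∃ e ∈ G, S ⊆ e ∧ Disjoint e F

lemma homfree_aux {r : ℕ} {V : Type*} [DecidableEq V] {H G : Finset (Finset V)}
    (hH : DeltaFree r H) (hr : ∀ e ∈ H, e.card = r) (hGH : G ⊆ H) (hG : Robust r G)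
    {A X Y : Finset V} (hA : A ∈ G) (hX : X ⊆ A) (hY : Y = A \ X) {z : V} (hz : z ∉ A)
    (hle : X.card ≤ Y.card)
    (hzX : Cov G (insert z X)) (hzY : Cov G (insert z Y)) : False := by
  have cA := hr A (hGH hA)
  have hXY : X.card + Y.card = r := by
    rw [hY, card_sdiff_of_subset hX, cA]
    have := card_le_card hX
    omega
  have hX1 : 1 ≤ X.card := by
    by_contra h
    have hX0 : X = ∅ := by rw [← card_eq_zero]; omega
    obtain ⟨e, he, hs⟩ := hzY
    have := card_le_card hs
    rw [card_insert_of_notMem (by rw [hY]; simp [hz]), hr e (hGH he)] at this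
    simp [hX0] at hXY
    omega
  obtain ⟨B, hB, hBs, hBd⟩ := hG (insert z X) Y hzX (by omega) (by
    rw [hY, disjoint_left]; intro v; simp only [mem_insert, mem_sdiff]
    rintro (rfl | h) <;> tauto)
  have cB := hr B (hGH hB)
  obtain ⟨C, hC, hCs, hCd⟩ := hG (insert z Y) ((A ∪ B) \ insert z Y) hzY (by
    refine (card_le_card sdiff_subset).trans ((card_union_le _ _).trans ?_); omega)
    disjoint_sdiff
  have cC := hr C (hGH hC)
  have hAB : A ∩ B = X := by
    ext v
    have h1 := @hBs v
    have h2 := @hX v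
    have h3 := fun h => (disjoint_left.1 hBd) (a := v) h
    rw [hY] at h3
    simp only [mem_inter, mem_insert, mem_sdiff] at *
    tauto
  have hzB : z ∈ B := hBs (mem_insert_self _ _)
  have hzC : z ∈ C := hCs (mem_insert_self _ _)
  refine mkT hH (hGH hA) (hGH hB) (hGH hC) cA cB cC hz (by rw [hAB]; exact hX1)
    (by rw [hAB]; omega) ?_ ?_
  · rw [← sdiff_inter_self_left, hAB, ← hY]
    ext v
    have h1 := @hCs v
    have h3 := fun h => (disjoint_left.1 hCd) (a := v) h
    have h4 : v ∈ Y → v ∈ A := by rw [hY]; simp; tauto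
    have h5 : v = z → v ∉ A := by rintro rfl; exact hz
    simp only [mem_inter, mem_insert, mem_sdiff, mem_union] at *
    tauto
  · ext v
    have h3 := fun h => (disjoint_left.1 hCd) (a := v) h
    have h4 := fun h => (disjoint_left.1 hBd) (a := v) h
    have h5 : v = z → v ∈ B ∧ v ∈ C := by rintro rfl; exact ⟨hzB, hzC⟩
    simp only [mem_inter, mem_insert, mem_sdiff, mem_union, mem_singleton] at *
    tauto

lemma homfree {r : ℕ} {V : Type*} [DecidableEq V] {H G : Finset (Finset V)}
    (hH : DeltaFree r H) (hr : ∀ e ∈ H, e.card = r) (hGH : G ⊆ H) (hG : Robust r G)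
    {A S T : Finset V} (hA : A ∈ G) (hS : S ⊆ A) (hST : A ⊆ S ∪ T) {z : V} (hz : z ∉ A)
    (hzS : Cov G (insert z S)) (hzT : Cov G (insert z T)) : False := by
  have hzT' : Cov G (insert z (A \ S)) := by
    obtain ⟨e, he, hs⟩ := hzT
    refine ⟨e, he, (insert_subset_insert z ?_).trans hs⟩
    intro v hv
    rcases mem_union.1 (hST (mem_sdiff.1 hv).1) with h | h
    · exact absurd h (mem_sdiff.1 hv).2
    · exact h
  rcases le_total S.card (A \ S).card with h | h
  · exact homfree_aux hH hr hGH hG hA hS rfl hz h hzS hzT'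
  · exact homfree_aux hH hr hGH hG hA sdiff_subset (Finset.sdiff_sdiff_eq_self hS).symm hz h hzT' hzS

/-- The number of `r`-sets of a family containing `S` is at most `n^(r-|S|)`. -/
lemma card_filter_superset_le {r : ℕ} {V : Type*} [DecidableEq V] [Fintype V]
    (H : Finset (Finset V)) (hr : ∀ e ∈ H, e.card = r) (S : Finset V) :
    (H.filter (fun e => S ⊆ e)).card ≤ (Fintype.card V) ^ (r - S.card) := by
  have : (H.filter (fun e => S ⊆ e)).card ≤ (powersetCard (r - S.card) (univ : Finset V)).card := by
    apply card_le_card_of_injOn (fun e => e \ S)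
    · intro e he
      simp only [coe_filter, Set.mem_ofPred_eq] at he
      simp only [mem_coe, mem_powersetCard, subset_univ, true_and]
      rw [card_sdiff_of_subset he.2, hr e he.1]
    · intro e he e' he' hee
      simp only [coe_filter, Set.mem_ofPred_eq] at he he' hee
      rw [← sdiff_union_of_subset he.2, hee, sdiff_union_of_subset he'.2]
  refine this.trans ?_
  rw [card_powersetCard, card_univ]
  exact Nat.choose_le_pow _ _

/-- Deletion lemma. -/
lemma exists_robust {r : ℕ} {V : Type*} [DecidableEq V] [Fintype V] [Nonempty V]
    (H : Finset (Finset V)) (hr : ∀ e ∈ H, e.card = r) :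
    ∃ G ⊆ H, Robust r G ∧ H.card ≤ G.card + (2 * r + 1) * (r * (Fintype.card V) ^ (r - 1)) := by
  classical
  set n := Fintype.card V with hn
  have hn0 : 0 < n := Fintype.card_pos
  let sh : Finset (Finset V) → Finset (Finset V) := fun G =>
    univ.filter (fun S => S.card < r ∧ Cov G S)
  let Φ : Finset (Finset V) → ℤ := fun G => ∑ S ∈ sh G, (n : ℤ) ^ (r - 1 - S.card)
  obtain ⟨G, hGH, hmax⟩ := exists_max_image H.powerset
    (fun G => (G.card : ℤ) - (2 * r + 1) * Φ G) ⟨H, by simp⟩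
  rw [mem_powerset] at hGH
  refine ⟨G, hGH, ?_, ?_⟩
  · intro S F hS hF hd
    by_contra hcon
    push Not at hcon
    have hrG : ∀ e ∈ G, e.card = r := fun e he => hr e (hGH he)
    have hSr : S.card < r := by
      obtain ⟨e, he, hs⟩ := hS
      by_contra h
      have heq : S = e := eq_of_subset_of_card_le hs (by rw [hrG e he]; omega)
      exact hcon e he hs (heq ▸ hd)
    let G1 := G.filter (fun e => ¬ S ⊆ e)
    have hG1 : G1 ⊆ H := (filter_subset _ _).trans hGH
    have hle := hmax G1 (by simpa using hG1)
    have hdel : (G.filter (fun e => S ⊆ e)).card ≤ 2 * r * n ^ (r - 1 - S.card) := by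
      have hsub : G.filter (fun e => S ⊆ e) ⊆
          F.biUnion (fun f => G.filter (fun e => insert f S ⊆ e)) := by
        intro e he
        rw [mem_filter] at he
        have := hcon e he.1 he.2
        rw [not_disjoint_iff] at this
        obtain ⟨f, hfe, hfF⟩ := this
        simp only [mem_biUnion, mem_filter]
        exact ⟨f, hfF, he.1, insert_subset hfe he.2⟩
      refine (card_le_card hsub).trans ?_
      refine (card_biUnion_le_card_mul _ _ (n ^ (r - 1 - S.card)) ?_).trans
        (Nat.mul_le_mul_right _ hF)
      intro f hf
      have hfS : f ∉ S := fun h => (disjoint_left.1 hd h hf)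
      have := card_filter_superset_le G hrG (insert f S)
      rw [card_insert_of_notMem hfS] at this
      rwa [show r - 1 - S.card = r - (S.card + 1) by omega]
    have hcard : G.card = G1.card + (G.filter (fun e => S ⊆ e)).card := by
      have := card_filter_add_card_filter_not (s := G) (fun e => S ⊆ e)
      simp only [G1]; omega
    have hΦ : Φ G1 + (n : ℤ) ^ (r - 1 - S.card) ≤ Φ G := by
      have hsub : insert S (sh G1) ⊆ sh G := by
        apply insert_subset
        · simp only [sh, mem_filter, mem_univ, true_and]; exact ⟨hSr, hS⟩
        · intro T hT
          simp only [sh, mem_filter, mem_univ, true_and] at hT ⊢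
          obtain ⟨h1, e, he, hs⟩ := hT
          exact ⟨h1, e, (mem_filter.1 he).1, hs⟩
      have hnot : S ∉ sh G1 := by
        simp only [sh, mem_filter, mem_univ, true_and]
        rintro ⟨_, e, he, hs⟩
        exact (mem_filter.1 he).2 hs
      have := sum_le_sum_of_subset_of_nonneg (f := fun S : Finset V => (n : ℤ) ^ (r - 1 - S.card))
        hsub (fun _ _ _ => by positivity)
      rw [sum_insert hnot] at this
      simp only [Φ]; linarith
    have hpos : (0 : ℤ) < (n : ℤ) ^ (r - 1 - S.card) := by positivity
    have hdel' : ((G.filter (fun e => S ⊆ e)).card : ℤ) ≤ 2 * r * (n : ℤ) ^ (r - 1 - S.card) := by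
      exact_mod_cast hdel
    have hcard' : (G.card : ℤ) = G1.card + (G.filter (fun e => S ⊆ e)).card := by
      exact_mod_cast hcard
    have := mul_le_mul_of_nonneg_left hΦ (show (0 : ℤ) ≤ 2 * r + 1 by positivity)
    nlinarith
  · have hle := hmax H (by simp)
    have hG0 : 0 ≤ Φ G := sum_nonneg (fun _ _ => by positivity)
    have hΦH : Φ H ≤ r * (n : ℤ) ^ (r - 1) := by
      have h1 : Φ H ≤ ∑ S ∈ (range r).biUnion (fun s => powersetCard s (univ : Finset V)),
          (n : ℤ) ^ (r - 1 - S.card) := by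
        apply sum_le_sum_of_subset_of_nonneg
        · intro S hS
          simp only [sh, mem_filter, mem_univ, true_and] at hS
          simp [hS.1]
        · intros; positivity
      refine h1.trans ?_
      rw [sum_biUnion]
      · have : ∀ s ∈ range r, ∑ S ∈ powersetCard s (univ : Finset V),
            (n : ℤ) ^ (r - 1 - S.card) ≤ (n : ℤ) ^ (r - 1) := by
          intro s hs
          rw [mem_range] at hs
          have : ∑ S ∈ powersetCard s (univ : Finset V),
            (n : ℤ) ^ (r - 1 - S.card) = ∑ S ∈ powersetCard s (univ : Finset V),
            (n : ℤ) ^ (r - 1 - s) := by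
            apply sum_congr rfl
            intro S hS
            rw [(mem_powersetCard.1 hS).2]
          rw [this, sum_const, card_powersetCard, card_univ, ← hn, nsmul_eq_mul]
          have h2 : ((n.choose s : ℕ) : ℤ) ≤ (n : ℤ) ^ s := by exact_mod_cast Nat.choose_le_pow _ _
          calc _ ≤ (n : ℤ) ^ s * (n : ℤ) ^ (r - 1 - s) := by gcongr
            _ = _ := by rw [← pow_add]; congr 1; omega
        refine (sum_le_sum this).trans ?_
        simp
      · intro s _ t _ hst
        exact pairwise_disjoint_powersetCard _ hst
    have := mul_le_mul_of_nonneg_left hΦH (show (0 : ℤ) ≤ 2 * r + 1 by positivity)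
    have h3 : (0 : ℤ) ≤ (2 * r + 1) * Φ G := by positivity
    zify
    linarith

end HMantel

namespace HMantel

open Finset

open Classical in
/-- Shadow neighbourhood of a set. -/
noncomputable def NB {V : Type*} [DecidableEq V] [Fintype V] (G : Finset (Finset V)) (S : Finset V) :
    Finset V := univ.filter (fun z => z ∉ S ∧ Cov G (insert z S))

lemma mem_NB {V : Type*} [DecidableEq V] [Fintype V] {G : Finset (Finset V)} {S : Finset V} {z : V} :
    z ∈ NB G S ↔ z ∉ S ∧ Cov G (insert z S) := by
  simp [NB]

lemma NB_anti {V : Type*} [DecidableEq V] [Fintype V] {G : Finset (Finset V)} {S T : Finset V}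
    (h : S ⊆ T) : NB G T ⊆ NB G S := by
  intro z hz
  rw [mem_NB] at hz ⊢
  obtain ⟨h1, e, he, hs⟩ := hz
  exact ⟨fun h' => h1 (h h'), e, he, (insert_subset_insert z h).trans hs⟩

/-- The weights of the random greedy process sum to at most one. -/
lemma lym {V : Type*} [DecidableEq V] [Fintype V] (k : ℕ) : ∀ N : Finset V → Finset V,
    ∑ x : Fin k → V, ∏ i : Fin k, (if x i ∈ N ((univ.filter (fun j => j < i)).image x)
      then (1 / ((N ((univ.filter (fun j => j < i)).image x)).card : ℝ)) else 0) ≤ 1 := by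
  induction k with
  | zero => intro N; simp
  | succ k ih =>
    intro N
    rw [← (Fin.consEquiv (fun _ : Fin (k+1) => V)).sum_comp, Fintype.sum_prod_type]
    have hstep : ∀ v : V, ∑ x : Fin k → V, ∏ i : Fin (k+1),
        (if (Fin.consEquiv (fun _ : Fin (k+1) => V)) (v, x) i ∈ N ((univ.filter (fun j => j < i)).image ((Fin.consEquiv (fun _ : Fin (k+1) => V)) (v, x)))
        then (1 / ((N ((univ.filter (fun j => j < i)).image ((Fin.consEquiv (fun _ : Fin (k+1) => V)) (v, x)))).card : ℝ)) else 0)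
        ≤ (if v ∈ N ∅ then 1 / ((N ∅).card : ℝ) else 0) := by
      intro v
      have hset : ∀ (x : Fin k → V) (i : Fin k),
          (univ.filter (fun j => j < i.succ)).image (Fin.cons v x : Fin (k+1) → V)
            = insert v ((univ.filter (fun j => j < i)).image x) := by
        intro x i
        ext w
        simp only [mem_image, mem_filter, mem_univ, true_and, mem_insert]
        constructor
        · rintro ⟨j, hj, rfl⟩
          refine Fin.cases ?_ (fun j hj => ?_) j hj
          · intro _; left; simp
          · right; exact ⟨j, by simpa using hj, by simp⟩
        · rintro (rfl | ⟨j, hj, rfl⟩)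
          · exact ⟨0, Fin.succ_pos i, by simp⟩
          · exact ⟨j.succ, by simpa using hj, by simp⟩
      have h0 : ∀ (x : Fin k → V), (univ.filter (fun j : Fin (k+1) => j < 0)).image (Fin.cons v x : Fin (k+1) → V) = ∅ := by
        intro x
        simp
      have heq : ∀ x : Fin k → V, (Fin.consEquiv (fun _ : Fin (k+1) => V)) (v, x)
          = (Fin.cons v x : Fin (k+1) → V) := fun x => rfl
      simp only [heq, Fin.prod_univ_succ, hset, h0, Fin.cons_zero, Fin.cons_succ]
      rw [← mul_sum]
      have := ih (fun S => N (insert v S))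
      have hnn : (0 : ℝ) ≤ (if v ∈ N ∅ then 1 / ((N ∅).card : ℝ) else 0) := by
        split_ifs <;> positivity
      exact mul_le_of_le_one_right hnn this
    refine (sum_le_sum (fun v _ => hstep v)).trans ?_
    rw [← sum_filter, sum_const, nsmul_eq_mul]
    have : univ.filter (fun v => v ∈ N ∅) = N ∅ := by ext; simp
    rw [this]
    rcases eq_or_ne ((N ∅).card : ℝ) 0 with h | h
    · rw [h]; simp
    · rw [mul_one_div_cancel h]

/-- Sums over permutation invariant families depend only on the cardinality. -/
lemma sum_image_eq {V : Type*} [DecidableEq V] {r : ℕ} (E : Finset (Fin r → V))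
    (hE : ∀ (σ : Equiv.Perm (Fin r)), ∀ x ∈ E, x ∘ σ ∈ E) (g : Finset V → ℝ)
    {T T' : Finset (Fin r)} (h : T.card = T'.card) :
    ∑ x ∈ E, g (T.image x) = ∑ x ∈ E, g (T'.image x) := by
  classical
  let e : {i // i ∈ T} ≃ {i // i ∈ T'} := Finset.equivOfCardEq h
  let σ : Equiv.Perm (Fin r) := e.extendSubtype
  have hσ : T.image σ = T' := by
    apply eq_of_subset_of_card_le
    · intro v hv
      obtain ⟨i, hi, rfl⟩ := mem_image.1 hv
      exact e.extendSubtype_mem i hi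
    · rw [card_image_of_injective _ σ.injective, h]
  symm
  refine sum_bij' (fun x _ => x ∘ σ) (fun x _ => x ∘ σ.symm) ?_ ?_ ?_ ?_ ?_
  · intro x hx; exact hE σ x hx
  · intro x hx; exact hE σ.symm x hx
  · intro x hx; ext i; simp
  · intro x hx; ext i; simp
  · intro x hx
    rw [← hσ, image_image]

lemma apmo (r : ℕ) (a : ℕ → ℝ)
    (h : ∀ s t, 1 ≤ s → 1 ≤ t → s + t ≤ r → a s + a t ≤ a (s + t)) :
    ∀ k, 1 ≤ k → k ≤ r → ∑ i ∈ range k, a (i+1) / ((i : ℝ) + 1) ≤ a k := by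
  intro k
  induction k using Nat.strong_induction_on with
  | _ k ih =>
  intro hk hkr
  obtain ⟨m, rfl⟩ : ∃ m, k = m + 1 := ⟨k - 1, by omega⟩
  have hsum : ∀ (c : ℕ → ℝ) (m : ℕ), ∑ k ∈ range m, ∑ i ∈ range (k+1), c i
      = ∑ i ∈ range m, ((m : ℝ) - i) * c i := by
    intro c m
    induction m with
    | zero => simp
    | succ m ihm =>
      rw [sum_range_succ, ihm, sum_range_succ, sum_range_succ, ← add_assoc, ← sum_add_distrib]
      push_cast
      congr 1
      · apply sum_congr rfl; intros; ring
      · ring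
  have h1 : ∑ k ∈ range m, ∑ i ∈ range (k+1), a (i+1) / ((i : ℝ) + 1) ≤ ∑ k ∈ range m, a (k+1) := by
    apply sum_le_sum
    intro j hj
    rw [mem_range] at hj
    exact ih (j+1) (by omega) (by omega) (by omega)
  rw [hsum] at h1
  have h2 : ∑ i ∈ range m, ((m : ℝ) - i) * (a (i+1) / ((i : ℝ) + 1))
      = ((m : ℝ) + 1) * ∑ i ∈ range m, a (i+1) / ((i : ℝ) + 1) - ∑ i ∈ range m, a (i+1) := by
    rw [mul_sum, ← sum_sub_distrib]
    apply sum_congr rfl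
    intro i _
    have : (i : ℝ) + 1 ≠ 0 := by positivity
    field_simp
    ring
  have h3 : 2 * ∑ i ∈ range m, a (i+1) ≤ m * a (m+1) := by
    have hrefl := sum_range_reflect (fun i => a (i+1)) m
    have : ∑ i ∈ range m, (a (i+1) + a (m - 1 - i + 1)) ≤ ∑ i ∈ range m, a (m+1) := by
      apply sum_le_sum
      intro i hi
      rw [mem_range] at hi
      have := h (i+1) (m - 1 - i + 1) (by omega) (by omega) (by omega)
      rwa [show i + 1 + (m - 1 - i + 1) = m + 1 by omega] at this
    rw [sum_add_distrib, hrefl, sum_const, card_range, nsmul_eq_mul] at this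
    linarith
  rw [sum_range_succ]
  have hm : (0 : ℝ) < m + 1 := by positivity
  have h4 : ((m : ℝ) + 1) * ∑ i ∈ range m, a (i+1) / ((i : ℝ) + 1) ≤ m * a (m+1) := by linarith
  have h5 : ((m : ℝ) + 1) * (∑ i ∈ range m, a (i+1) / ((i : ℝ) + 1) + a (m+1) / ((m : ℝ)+1))
      ≤ (m+1) * a (m+1) := by
    rw [mul_add, mul_div_cancel₀ _ hm.ne']
    linarith
  exact le_of_mul_le_mul_left h5 hm

lemma exp_bound (y : ℝ) (hy : 0 ≤ y) : y ≤ Real.exp (y - 1 - (1 - √y)^2) := by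
  have h1 : √y ≤ Real.exp (√y - 1) := by
    have := Real.add_one_le_exp (√y - 1); linarith
  have h2 : y = √y ^ 2 := (Real.sq_sqrt hy).symm
  have h3 : y - 1 - (1 - √y)^2 = (√y - 1) + (√y - 1) := by nlinarith
  rw [h3, Real.exp_add]
  calc y = √y * √y := by rw [← sq]; exact h2
    _ ≤ _ := by gcongr

lemma prod_inv_bound {r : ℕ} (y : Fin r → ℝ) (hy : ∀ i, 0 < y i) (j : Fin r) (δ : ℝ) (hδ : 0 ≤ δ) :
    1 + ∑ i, (1 - y i) + (δ * (1 - y j) / 2 - δ^2 / 4) ≤ ∏ i, (y i)⁻¹ := by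
  let u : Fin r → ℝ := fun i => 1 - y i + if i = j then (1 - √(y j))^2 else 0
  have h1 : ∀ i, Real.exp (u i) ≤ (y i)⁻¹ := by
    intro i
    have hb : y i ≤ Real.exp (- u i) := by
      have h2 := exp_bound (y i) (hy i).le
      refine h2.trans (Real.exp_le_exp.2 ?_)
      simp only [u]
      split_ifs with h
      · subst h; linarith
      · nlinarith [sq_nonneg (1 - √(y i))]
    rw [Real.exp_neg] at hb
    exact (le_inv_comm₀ (hy i) (Real.exp_pos _)).1 hb
  have h2 : Real.exp (∑ i, u i) ≤ ∏ i, (y i)⁻¹ := by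
    rw [Real.exp_sum]
    exact prod_le_prod (fun i _ => (Real.exp_pos _).le) (fun i _ => h1 i)
  have h3 : ∑ i, u i = ∑ i, (1 - y i) + (1 - √(y j))^2 := by
    simp only [u]
    rw [sum_add_distrib]
    simp
  have h4 := Real.add_one_le_exp (∑ i, u i)
  have h5 : √(y j) ^ 2 = y j := Real.sq_sqrt (hy j).le
  have h6 : δ * (1 - y j) / 2 - δ^2 / 4 ≤ (1 - √(y j))^2 := by
    nlinarith [sq_nonneg (1 - √(y j) - δ/2), mul_nonneg hδ (sq_nonneg (1 - √(y j)))]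
  linarith

lemma card_ordered {V : Type*} [DecidableEq V] [Fintype V] {r : ℕ} (G : Finset (Finset V))
    (hr : ∀ e ∈ G, e.card = r) :
    r.factorial * G.card ≤ ((univ : Finset (Fin r → V)).filter (fun x => univ.image x ∈ G)).card := by
  apply mul_card_image_le_card_of_maps_to (f := fun x : Fin r → V => univ.image x)
  · intro x hx
    exact (mem_filter.1 hx).2
  · intro e he
    have : (univ : Finset (Equiv.Perm (Fin r))).card = r.factorial := by
      rw [card_univ, Fintype.card_perm, Fintype.card_fin]
    rw [← this]
    let q : Fin r ≃ {v // v ∈ e} := (Finset.equivFinOfCardEq (hr e he)).symm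
    apply card_le_card_of_injOn (fun σ i => (q (σ i) : V))
    · intro σ _
      have heq : univ.image (fun i => (q (σ i) : V)) = e := ?_
      · simp only [coe_filter, mem_filter, mem_univ, true_and, Set.mem_ofPred_eq]
        rw [heq]; exact ⟨he, rfl⟩
      ext v
      simp only [mem_image, mem_univ, true_and]
      constructor
      · rintro ⟨i, rfl⟩; exact (q (σ i)).2
      · intro hv
        exact ⟨σ.symm (q.symm ⟨v, hv⟩), by simp⟩
    · intro σ _ τ _ h
      ext i
      have := congrFun h i
      simp only at this
      have := q.injective (Subtype.ext this)
      rw [this]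

/-- Initial segments of `Fin r`. -/
def seg (r m : ℕ) : Finset (Fin r) := univ.filter (fun j => j.val < m)

lemma card_seg (r m : ℕ) (h : m ≤ r) : (seg r m).card = m := by
  rw [seg, Fin.card_filter_val_lt]; omega

set_option maxHeartbeats 1000000 in
/-- Counting bound with stability. -/
lemma stab_count {r : ℕ} (hr2 : 2 ≤ r) {V : Type*} [DecidableEq V] [Fintype V] [Nonempty V]
    {H G : Finset (Finset V)}
    (hH : DeltaFree r H) (hr : ∀ e ∈ H, e.card = r) (hGH : G ⊆ H) (hG : Robust r G)
    (δ : ℝ) (hδ : 0 ≤ δ)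
    (hA : ∀ A ∈ G, ∑ a ∈ A, ((NB G (A.erase a)).card : ℝ) ≤ (1 - δ) * Fintype.card V) :
    (G.card : ℝ) * (1 + δ^2 / 4) * (r : ℝ)^r ≤ (Fintype.card V : ℝ)^r := by
  classical
  set n := Fintype.card V with hn
  have hn0 : 0 < n := Fintype.card_pos
  have hn0' : (0 : ℝ) < n := by exact_mod_cast hn0
  have hr0' : (0 : ℝ) < r := by exact_mod_cast (by omega : 0 < r)
  have hrG : ∀ e ∈ G, e.card = r := fun e he => hr e (hGH he)
  set E := (univ : Finset (Fin r → V)).filter (fun x => univ.image x ∈ G) with hEdef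
  have hEmem : ∀ x, x ∈ E ↔ univ.image x ∈ G := by intro x; simp [E]
  have hinj : ∀ x ∈ E, Function.Injective x := by
    intro x hx
    have := hrG _ ((hEmem x).1 hx)
    have h2 : Set.InjOn x (univ : Finset (Fin r)) := by
      apply card_image_iff.1; rw [this]; simp
    simpa [Set.injOn_univ] using h2
  have hEperm : ∀ (σ : Equiv.Perm (Fin r)), ∀ x ∈ E, x ∘ σ ∈ E := by
    intro σ x hx
    rw [hEmem] at hx ⊢
    rw [← image_image, image_univ_equiv]
    exact hx
  have hcE := card_ordered G hrG
  rw [← hEdef] at hcE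
  clear_value E n
  obtain ⟨c, hc⟩ : ∃ c : (Fin r → V) → ℕ → ℝ, ∀ x m, c x m = ((NB G ((seg r m).image x)).card : ℝ) :=
    ⟨_, fun _ _ => rfl⟩
  obtain ⟨f, hfd⟩ : ∃ f : ℕ → ℝ, ∀ m, f m = ∑ x ∈ E, c x m := ⟨_, fun _ => rfl⟩
  have hf : ∀ T : Finset (Fin r), ∑ x ∈ E, ((NB G (T.image x)).card : ℝ) = f T.card := by
    intro T
    have hT : T.card ≤ r := by simpa using card_le_univ T
    simp only [hfd, hc]
    exact sum_image_eq E hEperm (fun S => ((NB G S).card : ℝ)) (by rw [card_seg r _ hT])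
  -- superadditivity
  have hsup : ∀ s t, 1 ≤ s → 1 ≤ t → s + t ≤ r → f (r - s) + f (r - t) ≤ f (r - (s + t)) := by
    intro s t hs ht hst
    let T1 := seg r (r - s)
    let T2 : Finset (Fin r) := univ.filter (fun j => j.val < r - (s+t) ∨ r - s ≤ j.val)
    have hT2 : T2.card = r - t := by
      have h1 : T2 = seg r (r - (s+t)) ∪ (univ \ seg r (r - s)) := by
        ext j; simp [T2, seg]
      rw [h1, card_union_of_disjoint, card_seg _ _ (by omega), card_sdiff_of_subset (subset_univ _),
        card_seg _ _ (by omega), card_univ, Fintype.card_fin]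
      · omega
      · rw [disjoint_left]; intro j; simp [seg]; omega
    have e1 : f (r - t) = ∑ x ∈ E, ((NB G (T2.image x)).card : ℝ) := by rw [hf, hT2]
    rw [e1]
    simp only [hfd, hc]
    rw [← sum_add_distrib]
    apply sum_le_sum
    intro x hx
    have hxG := (hEmem x).1 hx
    have hd : Disjoint (NB G (T1.image x)) (NB G (T2.image x)) := by
      rw [disjoint_left]
      intro z h1 h2
      rw [mem_NB] at h1 h2
      have hcov : univ.image x ⊆ T1.image x ∪ T2.image x := by
        rw [← image_union]
        apply image_subset_image
        intro j _
        simp only [T1, T2, seg, mem_union, mem_filter, mem_univ, true_and]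
        omega
      refine homfree hH hr hGH hG hxG (image_subset_image (subset_univ T1)) hcov ?_ h1.2 h2.2
      intro hz
      rcases mem_union.1 (hcov hz) with h | h
      · exact h1.1 h
      · exact h2.1 h
    have hsub : NB G (T1.image x) ∪ NB G (T2.image x) ⊆ NB G ((seg r (r - (s+t))).image x) := by
      apply union_subset
      · apply NB_anti
        apply image_subset_image
        intro j; simp [T1, seg]; omega
      · apply NB_anti
        apply image_subset_image
        intro j; simp only [T2, seg, mem_filter, mem_univ, true_and]; tauto
    have := card_le_card hsub
    rw [card_union_of_disjoint hd] at this
    exact_mod_cast this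
  have hapmo := apmo r (fun s => f (r - s)) hsup r (by omega) le_rfl
  simp only [Nat.sub_self] at hapmo
  have hf0 : f 0 ≤ n * E.card := by
    simp only [hfd, hc]
    refine (sum_le_card_nsmul _ _ (n : ℝ) ?_).trans ?_
    · intro x _
      rw [hn]; exact_mod_cast card_le_univ _
    · rw [nsmul_eq_mul, mul_comm]
  -- the normalised quantities
  obtain ⟨y, hyd⟩ : ∃ y : (Fin r → V) → Fin r → ℝ, ∀ x i,
    y x i = r * c x i.val / (n * ((r : ℝ) - i.val)) := ⟨_, fun _ _ => rfl⟩
  have hri : ∀ i : Fin r, (0 : ℝ) < (r : ℝ) - i.val := by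
    intro i
    have : (i.val : ℝ) < r := by exact_mod_cast i.2
    linarith
  have hxmem : ∀ x ∈ E, ∀ i : Fin r, x i ∈ NB G ((seg r i.val).image x) := by
    intro x hx i
    rw [mem_NB]
    constructor
    · intro h
      obtain ⟨j, hj, hji⟩ := mem_image.1 h
      have := hinj x hx hji
      subst this
      simp [seg] at hj
    · refine ⟨_, (hEmem x).1 hx, ?_⟩
      apply insert_subset
      · exact mem_image_of_mem _ (mem_univ i)
      · exact image_subset_image (subset_univ _)
  have hNpos : ∀ x ∈ E, ∀ i : Fin r, 0 < c x i.val := by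
    intro x hx i
    rw [hc]
    exact_mod_cast card_pos.2 ⟨_, hxmem x hx i⟩
  have hy : ∀ x ∈ E, ∀ i, 0 < y x i := by
    intro x hx i
    have := hNpos x hx i
    have := hri i
    rw [hyd]; positivity
  let last : Fin r := ⟨r - 1, by omega⟩
  have hlow : ∑ x ∈ E, (1 + ∑ i, (1 - y x i) + (δ * (1 - y x last) / 2 - δ^2 / 4))
      ≤ ∑ x ∈ E, ∏ i, (y x i)⁻¹ :=
    sum_le_sum (fun x hx => prod_inv_bound (y x) (hy x hx) last δ hδ)
  have hysum : ∑ x ∈ E, ∑ i, y x i ≤ r * E.card := by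
    rw [sum_comm]
    have h1 : ∀ i : Fin r, ∑ x ∈ E, y x i = r / n * (f i.val / ((r : ℝ) - i.val)) := by
      intro i
      simp only [hyd, hfd]
      rw [sum_div, mul_sum]
      apply sum_congr rfl
      intro x _
      have := hri i
      field_simp
    rw [sum_congr rfl (fun i _ => h1 i), ← mul_sum]
    have h2 : ∑ i : Fin r, f i.val / ((r : ℝ) - i.val) = ∑ i ∈ range r, f (r - (i+1)) / ((i : ℝ) + 1) := by
      rw [Fin.sum_univ_eq_sum_range (fun i => f i / ((r : ℝ) - i)) r, ← sum_range_reflect]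
      apply sum_congr rfl
      intro i hi
      rw [mem_range] at hi
      rw [show r - 1 - i = r - (i+1) by omega, Nat.cast_sub (by omega)]
      push_cast
      congr 1; ring
    rw [h2]
    calc (r : ℝ) / n * ∑ i ∈ range r, f (r - (i+1)) / ((i : ℝ) + 1) ≤ r / n * (n * E.card) := by
          gcongr; exact hapmo.trans hf0
      _ = _ := by generalize (E.card : ℝ) = q; field_simp
  have hylast : ∑ x ∈ E, y x last ≤ (1 - δ) * E.card := by
    have h1 : ∑ x ∈ E, y x last = r / n * f (r - 1) := by
      simp only [hyd, hfd, last]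
      rw [mul_sum]
      apply sum_congr rfl
      intro x _
      rw [Nat.cast_sub (by omega)]
      push_cast
      rw [show (r : ℝ) - (r - 1) = 1 by ring]
      field_simp
    have h2 : (r : ℝ) * f (r - 1) = ∑ x ∈ E, ∑ j : Fin r, ((NB G ((univ.erase j).image x)).card : ℝ) := by
      rw [sum_comm]
      have : ∀ j : Fin r, ∑ x ∈ E, ((NB G ((univ.erase j).image x)).card : ℝ) = f (r - 1) := by
        intro j
        rw [hf, card_erase_of_mem (mem_univ j), card_univ, Fintype.card_fin]
      rw [sum_congr rfl (fun j _ => this j)]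
      simp
    have h3 : (r : ℝ) * f (r - 1) ≤ E.card * ((1 - δ) * n) := by
      rw [h2, ← nsmul_eq_mul]
      apply sum_le_card_nsmul
      intro x hx
      refine le_trans (le_of_eq ?_) (hA _ ((hEmem x).1 hx))
      rw [sum_image (fun i _ j _ h => hinj x hx h)]
      apply sum_congr rfl
      intro j _
      congr 3
      ext v
      simp only [mem_image, mem_erase, mem_univ, and_true, true_and]
      constructor
      · rintro ⟨i, hi, rfl⟩
        exact ⟨fun h => hi (hinj x hx h), i, rfl⟩
      · rintro ⟨h, i, rfl⟩
        exact ⟨i, fun h' => h (by rw [h']), rfl⟩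
    rw [h1]
    calc (r : ℝ) / n * f (r - 1) = (r * f (r-1)) / n := by ring
      _ ≤ (E.card * ((1 - δ) * n)) / n := by gcongr
      _ = _ := by generalize (E.card : ℝ) = q; field_simp
  have hlow2 : (E.card : ℝ) * (1 + δ^2 / 4) ≤ ∑ x ∈ E, ∏ i, (y x i)⁻¹ := by
    refine le_trans ?_ hlow
    have : ∑ x ∈ E, (1 + ∑ i, (1 - y x i) + (δ * (1 - y x last) / 2 - δ^2 / 4))
      = E.card * (1 + r + δ / 2 - δ^2/4) - ∑ x ∈ E, ∑ i, y x i - δ / 2 * ∑ x ∈ E, y x last := by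
      rw [mul_sum, ← nsmul_eq_mul, ← sum_const, ← sum_sub_distrib, ← sum_sub_distrib]
      apply sum_congr rfl
      intro x _
      rw [sum_sub_distrib]
      simp
      ring
    rw [this]
    nlinarith [mul_le_mul_of_nonneg_left hylast hδ]
  have hup : ∑ x ∈ E, ∏ i : Fin r, (1 / c x i.val) ≤ 1 := by
    refine le_trans ?_ (lym r (NB G) (V := V))
    refine le_trans (le_of_eq ?_) (sum_le_sum_of_subset_of_nonneg (subset_univ E) ?_)
    · apply sum_congr rfl
      intro x hx
      apply prod_congr rfl
      intro i _
      have : (univ.filter (fun j => j < i)) = seg r i.val := by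
        ext j; simp [seg]
      rw [this, if_pos (hxmem x hx i), hc]
    · intro x _ _
      apply prod_nonneg
      intro i _
      split_ifs
      · exact div_nonneg zero_le_one (Nat.cast_nonneg _)
      · exact le_rfl
  have hprod : ∀ x ∈ E, ∏ i : Fin r, (1 / c x i.val)
      = (r : ℝ)^r / (n^r * r.factorial) * ∏ i, (y x i)⁻¹ := by
    intro x hx
    have hfac : ∏ i : Fin r, ((r : ℝ) - i.val) = r.factorial := by
      rw [Fin.prod_univ_eq_prod_range (fun i => ((r : ℝ) - i)) r, ← prod_range_reflect,
        ← prod_range_add_one_eq_factorial]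
      push_cast
      apply prod_congr rfl
      intro i hi
      rw [mem_range] at hi
      rw [show r - 1 - i = r - (i+1) by omega, Nat.cast_sub (by omega)]
      push_cast
      ring
    have hK : (r : ℝ)^r / (n^r * r.factorial) = ∏ i : Fin r, (r / (n * ((r : ℝ) - i.val))) := by
      rw [prod_div_distrib, prod_mul_distrib, hfac]
      simp
    rw [hK, ← prod_mul_distrib]
    apply prod_congr rfl
    intro i _
    have h1 := hNpos x hx i
    have h2 := hri i
    rw [hyd]
    field_simp
  rw [sum_congr rfl hprod, ← mul_sum] at hup
  have hfpos : (0 : ℝ) < r.factorial := by exact_mod_cast Nat.factorial_pos r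
  have hKpos : (0 : ℝ) < (r : ℝ)^r / (n^r * r.factorial) := by positivity
  have hcE' : (r.factorial : ℝ) * G.card ≤ E.card := by exact_mod_cast hcE
  have h1 : (r : ℝ)^r / (n^r * r.factorial) * ((r.factorial : ℝ) * G.card * (1 + δ^2/4)) ≤ 1 := by
    refine le_trans ?_ hup
    gcongr
    refine le_trans ?_ hlow2
    gcongr
  have h2 : (r : ℝ)^r / (n^r * r.factorial) * ((r.factorial : ℝ) * G.card * (1 + δ^2/4))
      = (G.card : ℝ) * (1 + δ^2 / 4) * (r : ℝ)^r / n^r := by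
    generalize (G.card : ℝ) = q; field_simp
  rw [h2, div_le_one (by positivity)] at h1
  exact h1

end HMantel

namespace HMantel

open Finset

/-- Partial transversals missing coordinate `k` (filled with a dummy `p`). -/
def DD {V : Type*} [DecidableEq V] {r : ℕ} (U : Fin r → Finset V) (p : V) (k : Fin r) :
    Finset (Fin r → V) := Fintype.piFinset (Function.update U k {p})

/-- Those partial transversals which form an edge together with `v`. -/
def LL {V : Type*} [DecidableEq V] {r : ℕ} (H : Finset (Finset V)) (U : Fin r → Finset V) (p : V)
    (k : Fin r) (v : V) : Finset (Fin r → V) :=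
  (DD U p k).filter (fun x => univ.image (Function.update x k v) ∈ H)

lemma mem_DD {V : Type*} [DecidableEq V] {r : ℕ} {U : Fin r → Finset V} {p : V} {k : Fin r}
    {x : Fin r → V} : x ∈ DD U p k ↔ x k = p ∧ ∀ l, l ≠ k → x l ∈ U l := by
  rw [DD, Fintype.mem_piFinset]
  constructor
  · intro h
    refine ⟨by simpa using h k, fun l hl => ?_⟩
    have := h l
    rwa [Function.update_of_ne hl] at this
  · rintro ⟨h1, h2⟩ l
    by_cases hl : l = k
    · subst hl; simp [h1]
    · rw [Function.update_of_ne hl]; exact h2 l hl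

lemma card_DD {V : Type*} [DecidableEq V] {r : ℕ} (U : Fin r → Finset V) (p : V) (k : Fin r) :
    (DD U p k).card = ∏ l ∈ univ.erase k, (U l).card := by
  rw [DD, Fintype.card_piFinset, ← mul_prod_erase univ _ (mem_univ k)]
  simp only [Function.update_self, card_singleton, one_mul]
  apply prod_congr rfl
  intro l hl
  rw [Function.update_of_ne (ne_of_mem_erase hl)]

lemma card_DD_mul {V : Type*} [DecidableEq V] {r : ℕ} (U : Fin r → Finset V) (p : V) (k : Fin r) :
    (U k).card * (DD U p k).card = ∏ l, (U l).card := by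
  rw [card_DD, mul_prod_erase univ (fun l => (U l).card) (mem_univ k)]

lemma image_update {V : Type*} [DecidableEq V] {r : ℕ} (x : Fin r → V) (k : Fin r) (v : V) :
    univ.image (Function.update x k v) = insert v ((univ.erase k).image x) := by
  rw [← insert_erase (mem_univ k), image_insert, Function.update_self]
  congr 1
  rw [erase_insert (notMem_erase _ _)]
  apply image_congr
  intro l hl
  exact Function.update_of_ne (by simpa using hl) _ _

lemma card_fix_one {V : Type*} [DecidableEq V] [Fintype V] {r : ℕ} (k : Fin r) (p : V)
    (S : Finset (Fin r → V)) (hS : ∀ x ∈ S, x k = p) :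
    S.card ≤ (Fintype.card V) ^ (r - 1) := by
  have : S ⊆ DD (fun _ => univ) p k := by
    intro x hx
    rw [mem_DD]
    exact ⟨hS x hx, fun _ _ => mem_univ _⟩
  refine (card_le_card this).trans ?_
  rw [card_DD]
  simp

lemma card_fix_two {V : Type*} [DecidableEq V] [Fintype V] {r : ℕ} (k l : Fin r) (hkl : l ≠ k)
    (p c : V) (S : Finset (Fin r → V)) (hS : ∀ x ∈ S, x k = p ∧ x l = c) :
    S.card ≤ (Fintype.card V) ^ (r - 2) := by
  have : S ⊆ DD (Function.update (fun _ => univ) l {c}) p k := by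
    intro x hx
    rw [mem_DD]
    refine ⟨(hS x hx).1, fun i _ => ?_⟩
    by_cases hi : i = l
    · subst hi; simp [(hS x hx).2]
    · rw [Function.update_of_ne hi]; exact mem_univ _
  refine (card_le_card this).trans ?_
  rw [card_DD, ← mul_prod_erase _ _ (show l ∈ univ.erase k by simp [hkl])]
  simp only [Function.update_self, card_singleton, one_mul]
  rw [prod_congr rfl (g := fun _ => Fintype.card V)]
  · rw [prod_const, card_erase_of_mem (by simp [hkl]), card_erase_of_mem (by simp)]
    simp [Nat.sub_sub]
  · intro i hi
    rw [Function.update_of_ne (ne_of_mem_erase hi)]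
    simp

lemma card_hits {V : Type*} [DecidableEq V] [Fintype V] {r : ℕ} (k : Fin r) (p : V)
    (C : Finset V) (S : Finset (Fin r → V))
    (hS : ∀ x ∈ S, x k = p ∧ ∃ l, l ≠ k ∧ x l ∈ C) :
    S.card ≤ r * (C.card * (Fintype.card V) ^ (r - 2)) := by
  have hsub : S ⊆ (univ : Finset (Fin r)).biUnion (fun l => C.biUnion (fun c =>
      S.filter (fun x => l ≠ k ∧ x l = c))) := by
    intro x hx
    obtain ⟨h1, l, hl, hc⟩ := hS x hx
    simp only [mem_biUnion, mem_univ, true_and, mem_filter]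
    exact ⟨l, x l, hc, hx, hl, rfl⟩
  refine (card_le_card hsub).trans ?_
  refine (card_biUnion_le_card_mul _ _ (C.card * (Fintype.card V) ^ (r - 2)) ?_).trans (by simp)
  intro l _
  apply card_biUnion_le_card_mul
  intro c _
  by_cases hl : l = k
  · simp [hl]
  · apply card_fix_two k l hl p c
    intro x hx
    rw [mem_filter] at hx
    exact ⟨(hS x hx.1).1, hx.2.2⟩

/-- If two vertices of an edge have overlapping transversal links we get a triangle. -/
lemma collision {V : Type*} [DecidableEq V] [Fintype V] {r : ℕ} {H : Finset (Finset V)}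
    (hr2 : 2 ≤ r)
    (hH : DeltaFree r H) (hr : ∀ e ∈ H, e.card = r) (U : Fin r → Finset V) (p : V) (k : Fin r)
    {C : Finset V} (hC : C ∈ H) {u v : V} (hu : u ∈ C) (hv : v ∈ C) (huv : u ≠ v)
    (hcard : (DD U p k).card + r * (r * (Fintype.card V) ^ (r - 2)) <
      (LL H U p k u).card + (LL H U p k v).card) : False := by
  have cC := hr C hC
  let hits := (DD U p k).filter (fun x => ∃ l, l ≠ k ∧ x l ∈ C)
  have hhits : hits.card ≤ r * (r * (Fintype.card V) ^ (r - 2)) := by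
    have := card_hits k p C hits (fun x hx => by
      simp only [hits, mem_filter] at hx
      exact ⟨(mem_DD.1 hx.1).1, hx.2⟩)
    rwa [cC] at this
  have hun : ((LL H U p k u) ∪ (LL H U p k v)).card ≤ (DD U p k).card :=
    card_le_card (union_subset (filter_subset _ _) (filter_subset _ _))
  have hui := card_union_add_card_inter (LL H U p k u) (LL H U p k v)
  have hlt : hits.card < ((LL H U p k u) ∩ (LL H U p k v)).card := by omega
  obtain ⟨x, hx, hxh⟩ := exists_mem_notMem_of_card_lt_card hlt
  rw [mem_inter, LL, LL, mem_filter, mem_filter] at hx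
  obtain ⟨⟨hxD, hxu⟩, ⟨_, hxv⟩⟩ := hx
  rw [image_update] at hxu hxv
  set X := (univ.erase k).image x with hX
  have hXC : ∀ w ∈ X, w ∉ C := by
    intro w hw hwC
    obtain ⟨l, hl, rfl⟩ := mem_image.1 hw
    apply hxh
    simp only [hits, mem_filter]
    exact ⟨hxD, l, ne_of_mem_erase hl, hwC⟩
  have hvX : v ∉ X := fun h => hXC v h hv
  have h1 : insert u X ∩ C = {u} := by
    ext w
    have := hXC w
    simp only [mem_inter, mem_insert, mem_singleton]
    constructor
    · tauto
    · rintro rfl; tauto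
  refine mkT hH hxu hC hxv (hr _ hxu) cC (hr _ hxv) (z := v) ?_ ?_ ?_ ?_ ?_
  · rw [mem_insert]
    rintro (h | h)
    · exact huv h.symm
    · exact hvX h
  · rw [h1]; simp
  · rw [h1]; simp; omega
  · ext w
    have h2 := hXC w
    by_cases hwu : w = u
    · subst hwu
      have h3 : w ∉ X := fun h => h2 h hu
      simp [hu, huv, h3]
    · by_cases hwv : w = v
      · subst hwv; simp [hwu, hvX]
      · simp only [mem_inter, mem_insert, mem_sdiff, hwu, hwv, false_or]
        tauto
  · ext w
    have := hXC w
    simp only [mem_inter, mem_insert, mem_singleton]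
    constructor
    · tauto
    · rintro rfl; tauto

/-- An `r`-set which is covered by the parts and meets each at most once is a transversal. -/
lemma cover {V : Type*} [DecidableEq V] {r : ℕ} (U : Fin r → Finset V) (e : Finset V)
    (he : e.card = r) (h1 : ∀ u ∈ e, ∃ k, u ∈ U k)
    (h2 : ∀ k, ∀ u ∈ e, ∀ w ∈ e, u ∈ U k → w ∈ U k → u = w) :
    ∃ x ∈ Fintype.piFinset U, univ.image x = e := by
  choose c hc using h1
  let c' : {u // u ∈ e} → Fin r := fun u => c u.1 u.2
  have hinj : Function.Injective c' := by
    intro u w huw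
    apply Subtype.ext
    refine h2 (c u.1 u.2) u.1 u.2 w.1 w.2 (hc _ u.2) ?_
    have : c u.1 u.2 = c w.1 w.2 := huw
    rw [this]; exact hc _ w.2
  have hbij : Function.Bijective c' := by
    rw [Fintype.bijective_iff_injective_and_card]
    exact ⟨hinj, by simp [he]⟩
  let q := Equiv.ofBijective c' hbij
  refine ⟨fun k => (q.symm k).1, ?_, ?_⟩
  · rw [Fintype.mem_piFinset]
    intro k
    have h3 : c' (q.symm k) = k := q.apply_symm_apply k
    have h4 := hc _ (q.symm k).2
    have h5 : c (q.symm k).1 (q.symm k).2 = k := h3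
    rwa [h5] at h4
  · ext v
    simp only [mem_image, mem_univ, true_and]
    constructor
    · rintro ⟨k, rfl⟩; exact (q.symm k).2
    · intro hv; exact ⟨q ⟨v, hv⟩, by simp⟩

lemma prod_le_one_of_sum {r : ℕ} (y : Fin r → ℝ) (hy : ∀ i, 0 ≤ y i) (h : ∑ i, y i ≤ r) :
    ∏ i, y i ≤ 1 := by
  have h1 : ∏ i, y i ≤ ∏ i, Real.exp (y i - 1) := by
    apply prod_le_prod (fun i _ => hy i)
    intro i _
    have := Real.add_one_le_exp (y i - 1); linarith
  rw [← Real.exp_sum, sum_sub_distrib] at h1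
  refine h1.trans ?_
  rw [Real.exp_le_one_iff]
  simp
  linarith

lemma amgm {r : ℕ} (hr : 0 < r) (m : Fin r → ℕ) (n : ℕ) (hn : 0 < n) (h : ∑ i, m i ≤ n) :
    ((∏ i, m i : ℕ) : ℝ) ≤ (n : ℝ)^r / (r : ℝ)^r := by
  have hn' : (0 : ℝ) < n := by exact_mod_cast hn
  have hr' : (0 : ℝ) < r := by exact_mod_cast hr
  have := prod_le_one_of_sum (fun i => (r : ℝ) / n * m i) (fun i => by positivity) (by
    rw [← mul_sum]
    have h' : ∑ i, (m i : ℝ) ≤ n := by exact_mod_cast h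
    calc (r : ℝ) / n * ∑ i, (m i : ℝ) ≤ r / n * n := by gcongr
      _ = r := by field_simp)
  rw [prod_mul_distrib, prod_const, card_univ, Fintype.card_fin, div_pow] at this
  push_cast
  generalize ∏ i, (m i : ℝ) = q at *
  rw [le_div_iff₀ (by positivity)]
  rw [div_mul_eq_mul_div, div_le_one (by positivity)] at this
  linarith

/-- Near-extremal structure. -/
structure Stab {V : Type} [DecidableEq V] [Fintype V] {r : ℕ} (H : Finset (Finset V))
    (U : Fin r → Finset V) (p : V) (η : ℝ) : Prop where
  disj : ∀ k l, k ≠ l → Disjoint (U k) (U l)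
  one : ∀ e ∈ H, ∀ k, ∀ u ∈ e, ∀ w ∈ e, u ∈ U k → w ∈ U k → u = w
  rest : ((univ.filter (fun v => ∀ k, v ∉ U k)).card : ℝ) ≤ η * Fintype.card V
  typ : ∀ k, ∀ u ∈ U k, ((DD U p k).card : ℝ) - η * (Fintype.card V : ℝ)^(r - 1) ≤ (LL H U p k u).card
  prod : (1 / (r : ℝ)^r - η) * (Fintype.card V : ℝ)^r ≤ ((∏ k, (U k).card : ℕ) : ℝ)

end HMantel

namespace HMantel

open Finset

lemma U0_disj {r : ℕ} {V : Type*} [DecidableEq V] [Fintype V] {H G : Finset (Finset V)}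
    (hH : DeltaFree r H) (hr : ∀ e ∈ H, e.card = r) (hGH : G ⊆ H) (hG : Robust r G)
    {A : Finset V} (hA : A ∈ G) {a b : V} (hab : a ≠ b) :
    Disjoint (NB G (A.erase a)) (NB G (A.erase b)) := by
  rw [Finset.disjoint_left]
  intro z hz1 hz2
  rw [mem_NB] at hz1 hz2
  by_cases hzA : z ∈ A
  · have h1 : z = a := by by_contra h; exact hz1.1 (mem_erase.2 ⟨h, hzA⟩)
    have h2 : z = b := by by_contra h; exact hz2.1 (mem_erase.2 ⟨h, hzA⟩)
    exact hab (h1.symm.trans h2)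
  · refine homfree hH hr hGH hG hA (S := A.erase a) (T := A.erase b) (erase_subset _ _) ?_ hzA hz1.2 hz2.2
    intro w hw
    by_cases hwa : w = a
    · subst hwa; exact mem_union_right _ (mem_erase.2 ⟨hab, hw⟩)
    · exact mem_union_left _ (mem_erase.2 ⟨hwa, hw⟩)

lemma U0_one {r : ℕ} {V : Type*} [DecidableEq V] [Fintype V] {H G : Finset (Finset V)}
    (hH : DeltaFree r H) (hr : ∀ e ∈ H, e.card = r) (hGH : G ⊆ H) (hG : Robust r G)
    {A : Finset V} (hA : A ∈ G) {a : V} (ha : a ∈ A) {C : Finset V} (hC : C ∈ G) {u w : V}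
    (hu : u ∈ C) (hw : w ∈ C) (hu' : u ∈ NB G (A.erase a)) (hw' : w ∈ NB G (A.erase a)) :
    u = w := by
  by_contra huw
  rw [mem_NB] at hu' hw'
  have hA' : insert u (A.erase a) ∈ G := by
    obtain ⟨e, he, hs⟩ := hu'.2
    have : insert u (A.erase a) = e := by
      apply eq_of_subset_of_card_le hs
      rw [card_insert_of_notMem hu'.1, card_erase_of_mem ha, hr _ (hGH he), hr _ (hGH hA)]
      omega
    rwa [this]
  refine homfree hH hr hGH hG hA' (S := {u}) (T := A.erase a) (z := w) (by simp) ?_ ?_ ⟨C, hC, ?_⟩ hw'.2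
  · intro v hv
    simpa using hv
  · rw [mem_insert]
    rintro (h | h)
    · exact huw h.symm
    · exact hw'.1 h
  · intro v hv
    simp only [mem_insert, mem_singleton] at hv
    rcases hv with rfl | rfl <;> assumption

lemma clean {V : Type} [DecidableEq V] [Fintype V] {r : ℕ} {H : Finset (Finset V)}
    (hr2 : 2 ≤ r) (hH : DeltaFree r H) (hr : ∀ e ∈ H, e.card = r) (U : Fin r → Finset V) (s : ℝ)
    (hs : 0 < s) (hs2 : (r + 3) * s ≤ 1 / (2 * (r : ℝ)^r))
    (hn : 2 * (r : ℝ)^(r + 2) < Fintype.card V)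
    (hd : ∀ k l, k ≠ l → Disjoint (U k) (U l))
    (hrest : ((univ.filter (fun v => ∀ k, v ∉ U k)).card : ℝ) ≤ s * Fintype.card V)
    (hM : (((Fintype.piFinset U).filter (fun x => univ.image x ∉ H)).card : ℝ) ≤
      s^2 * (Fintype.card V : ℝ)^r)
    (hP : (1 / (r : ℝ)^r - s) * (Fintype.card V : ℝ)^r ≤ ((∏ k, (U k).card : ℕ) : ℝ)) :
    ∃ U' : Fin r → Finset V, ∀ p, Stab H U' p ((r + 1) * s) := by
  classical
  obtain ⟨n, hn'⟩ : ∃ n : ℕ, n = Fintype.card V := ⟨_, rfl⟩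
  rw [← hn'] at hn hrest hM hP
  have hr0 : (0 : ℝ) < r := by exact_mod_cast (by omega : 0 < r)
  have hn0 : (0 : ℝ) < n := lt_of_le_of_lt (by positivity) hn
  have hnr : (n : ℝ) * (n : ℝ)^(r - 1) = (n : ℝ)^r := by
    rw [← pow_succ']; congr 1; omega
  have hnr2 : (n : ℝ) * (n : ℝ)^(r - 2) = (n : ℝ)^(r - 1) := by
    rw [← pow_succ']; congr 1; omega
  set M := (Fintype.piFinset U).filter (fun x => univ.image x ∉ H) with hMdef
  let bad : Fin r → Finset V := fun k =>
    (U k).filter (fun v => s * (n : ℝ)^(r - 1) < ((M.filter (fun x => x k = v)).card : ℝ))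
  have hbad : ∀ k, ((bad k).card : ℝ) ≤ s * n := by
    intro k
    have h1 : ∑ v ∈ bad k, (M.filter (fun x => x k = v)).card ≤ M.card := by
      rw [← card_biUnion]
      · apply card_le_card
        intro x hx
        simp only [mem_biUnion, mem_filter] at hx
        obtain ⟨_, _, h, _⟩ := hx
        exact h
      · intro v _ w _ hvw
        rw [Function.onFun, Finset.disjoint_left]
        intro x h1 h2
        exact hvw ((mem_filter.1 h1).2.symm.trans (mem_filter.1 h2).2)
    have h2 : ((bad k).card : ℝ) * (s * (n : ℝ)^(r - 1)) ≤ (M.card : ℝ) := by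
      refine le_trans ?_ (Nat.cast_le.2 h1)
      rw [← nsmul_eq_mul]
      push_cast
      apply card_nsmul_le_sum
      intro v hv
      exact (mem_filter.1 hv).2.le
    have h3 := h2.trans hM
    have h4 : s^2 * (n : ℝ)^r = (s * n) * (s * (n : ℝ)^(r - 1)) := by rw [← hnr]; ring
    rw [h4] at h3
    exact le_of_mul_le_mul_right h3 (by positivity)
  let U' : Fin r → Finset V := fun k => U k \ bad k
  have hU' : ∀ k, U' k ⊆ U k := fun k => sdiff_subset
  have hprod : (1 / (r : ℝ)^r - (r + 1) * s) * (n : ℝ)^r ≤ ((∏ k, (U' k).card : ℕ) : ℝ) := by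
    rw [← Fintype.card_piFinset] at hP ⊢
    have hsub : Fintype.piFinset U ⊆ Fintype.piFinset U' ∪
        univ.biUnion (fun k => (bad k).biUnion (fun v =>
          (Fintype.piFinset U).filter (fun x => x k = v))) := by
      intro x hx
      by_cases h : x ∈ Fintype.piFinset U'
      · exact mem_union_left _ h
      · apply mem_union_right
        simp only [Fintype.mem_piFinset, not_forall] at h hx
        obtain ⟨k, hk⟩ := h
        have hb : x k ∈ bad k := by
          by_contra hb; exact hk (mem_sdiff.2 ⟨hx k, hb⟩)
        simp only [mem_biUnion, mem_univ, true_and, mem_filter]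
        exact ⟨k, x k, hb, Fintype.mem_piFinset.2 hx, rfl⟩
    have h1 := card_le_card hsub
    have h2 : (univ.biUnion (fun k => (bad k).biUnion (fun v =>
          (Fintype.piFinset U).filter (fun x => x k = v)))).card ≤
          ∑ k, (bad k).card * n^(r - 1) := by
      refine card_biUnion_le.trans (sum_le_sum fun k _ => ?_)
      apply card_biUnion_le_card_mul
      intro v _
      rw [hn']
      exact card_fix_one k v _ (fun x hx => (mem_filter.1 hx).2)
    have h3 : ((∑ k, (bad k).card * n^(r - 1) : ℕ) : ℝ) ≤ r * (s * (n : ℝ)^r) := by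
      push_cast
      calc ∑ k, ((bad k).card : ℝ) * (n : ℝ)^(r - 1) ≤ ∑ k : Fin r, (s * (n : ℝ)^r) := by
            apply sum_le_sum
            intro k _
            rw [← hnr, ← mul_assoc]
            exact mul_le_mul_of_nonneg_right (hbad k) (by positivity)
        _ = _ := by simp
    have h4 := h1.trans ((card_union_le _ _).trans (Nat.add_le_add_left h2 _))
    have h5 : ((Fintype.piFinset U).card : ℝ) ≤ (Fintype.piFinset U').card +
      ((∑ k, (bad k).card * n^(r - 1) : ℕ) : ℝ) := by exact_mod_cast h4
    linarith
  have htyp : ∀ p k, ∀ u ∈ U' k, ((DD U' p k).card : ℝ) - s * (n : ℝ)^(r - 1) ≤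
      (LL H U' p k u).card := by
    intro p k u hu
    have hu2 := mem_sdiff.1 hu
    have h1 : ((M.filter (fun x => x k = u)).card : ℝ) ≤ s * (n : ℝ)^(r - 1) := by
      by_contra h
      exact hu2.2 (mem_filter.2 ⟨hu2.1, not_le.1 h⟩)
    have h2 : ((DD U' p k).filter (fun x => univ.image (Function.update x k u) ∉ H)).card ≤
        (M.filter (fun x => x k = u)).card := by
      apply card_le_card_of_injOn (fun x => Function.update x k u)
      · intro x hx
        rw [mem_coe, mem_filter] at hx
        rw [mem_coe, mem_filter, hMdef, mem_filter, Fintype.mem_piFinset]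
        refine ⟨⟨fun l => ?_, hx.2⟩, by simp⟩
        by_cases hl : l = k
        · subst hl; simpa using hu2.1
        · show Function.update x k u l ∈ U l
          rw [Function.update_of_ne hl]
          exact hU' l ((mem_DD.1 hx.1).2 l hl)
      · intro x hx y hy hxy
        rw [mem_coe, mem_filter, mem_DD] at hx hy
        funext l
        by_cases hl : l = k
        · rw [hl, hx.1.1, hy.1.1]
        · have := congrFun hxy l
          simpa [Function.update_of_ne hl] using this
    have h3 := card_filter_add_card_filter_not (s := DD U' p k)
      (fun x => univ.image (Function.update x k u) ∈ H)
    have h4 : ((LL H U' p k u).card : ℝ) + ((DD U' p k).filter (fun x => univ.image (Function.update x k u) ∉ H)).card = (DD U' p k).card := by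
      exact_mod_cast h3
    have h5 := (Nat.cast_le (α := ℝ)).2 h2
    linarith
  have hDD : ∀ p k, (1 / (r : ℝ)^r - (r + 1) * s) * (n : ℝ)^(r - 1) ≤ (DD U' p k).card := by
    intro p k
    have h1 : ((U' k).card : ℝ) ≤ n := by
      rw [hn']; exact_mod_cast card_le_univ _
    rw [← card_DD_mul U' p k, ← hnr] at hprod
    push_cast at hprod
    have h2 : ((U' k).card : ℝ) * (DD U' p k).card ≤ n * (DD U' p k).card :=
      mul_le_mul_of_nonneg_right h1 (by positivity)
    have h3 : (n : ℝ) * ((1 / (r : ℝ)^r - (r + 1) * s) * (n : ℝ)^(r - 1)) ≤ n * (DD U' p k).card := by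
      linarith
    exact le_of_mul_le_mul_left h3 hn0
  have hs3 : s ≤ (r + 1) * s := by nlinarith
  refine ⟨U', fun p => ⟨?_, ?_, ?_, ?_, ?_⟩⟩
  · intro k l hkl
    exact Disjoint.mono (hU' k) (hU' l) (hd k l hkl)
  · intro e he k u hu w hw huU hwU
    by_contra huw
    refine collision hr2 hH hr U' p k he hu hw huw ?_
    have h1 := htyp p k u huU
    have h2 := htyp p k w hwU
    have h3 := hDD p k
    rw [← hn']
    have h4 : (r : ℝ) * (r * (n : ℝ)^(r - 2)) < 1 / (2 * (r : ℝ)^r) * (n : ℝ)^(r - 1) := by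
      rw [← hnr2, div_mul_eq_mul_div, lt_div_iff₀ (by positivity), one_mul, ← mul_assoc]
      have h5 : 2 * (r : ℝ)^(r + 2) * (n : ℝ)^(r - 2) < n * (n : ℝ)^(r - 2) :=
        mul_lt_mul_of_pos_right hn (by positivity)
      calc _ = 2 * (r : ℝ)^(r + 2) * (n : ℝ)^(r - 2) := by ring
        _ < _ := h5
    have h6 : (r + 3) * s * (n : ℝ)^(r - 1) ≤ 1 / (2 * (r : ℝ)^r) * (n : ℝ)^(r - 1) :=
      mul_le_mul_of_nonneg_right hs2 (by positivity)
    have h7 : 1 / (r : ℝ)^r * (n : ℝ)^(r - 1) = 1 / (2 * (r : ℝ)^r) * (n : ℝ)^(r - 1) + 1 / (2 * (r : ℝ)^r) * (n : ℝ)^(r - 1) := by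
      field_simp; ring
    have h8 : ((DD U' p k).card : ℝ) + r * (r * (n : ℝ)^(r - 2)) < (LL H U' p k u).card + (LL H U' p k w).card := by
      linarith
    exact_mod_cast h8
  · rw [← hn']
    have hsub : univ.filter (fun v => ∀ k, v ∉ U' k) ⊆
        univ.filter (fun v => ∀ k, v ∉ U k) ∪ univ.biUnion bad := by
      intro v hv
      simp only [mem_filter, mem_univ, true_and] at hv
      by_cases h : ∀ k, v ∉ U k
      · apply mem_union_left; simpa using h
      · push Not at h
        obtain ⟨k, hk⟩ := h
        apply mem_union_right
        rw [mem_biUnion]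
        refine ⟨k, mem_univ _, ?_⟩
        by_contra hb
        exact hv k (mem_sdiff.2 ⟨hk, hb⟩)
    have h1 := (card_le_card hsub).trans ((card_union_le _ _).trans
      (Nat.add_le_add_left card_biUnion_le _))
    have h2 : ((univ.filter (fun v => ∀ k, v ∉ U' k)).card : ℝ) ≤
        (univ.filter (fun v => ∀ k, v ∉ U k)).card + ∑ k, ((bad k).card : ℝ) := by
      exact_mod_cast h1
    have h3 : ∑ k, ((bad k).card : ℝ) ≤ ∑ k : Fin r, s * n := sum_le_sum fun k _ => hbad k
    rw [sum_const, card_univ, Fintype.card_fin, nsmul_eq_mul] at h3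
    linarith
  · intro k u hu
    rw [← hn']
    have := htyp p k u hu
    have h6 : s * (n : ℝ)^(r - 1) ≤ (r + 1) * s * (n : ℝ)^(r - 1) :=
      mul_le_mul_of_nonneg_right hs3 (by positivity)
    linarith
  · rw [← hn']; exact hprod


lemma Stab.mono {V : Type} [DecidableEq V] [Fintype V] {r : ℕ} {H : Finset (Finset V)}
    {U : Fin r → Finset V} {p : V} {η η' : ℝ} (h : Stab H U p η) (hη : η ≤ η') :
    Stab H U p η' := by
  have h1 : ∀ m : ℕ, η * (Fintype.card V : ℝ)^m ≤ η' * (Fintype.card V : ℝ)^m :=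
    fun m => mul_le_mul_of_nonneg_right hη (by positivity)
  refine ⟨h.disj, h.one, ?_, ?_, ?_⟩
  · have := h1 1
    rw [pow_one] at this
    exact h.rest.trans this
  · intro k u hu
    have := h.typ k u hu
    have := h1 (r - 1)
    linarith
  · have := h.prod
    have := h1 r
    linarith

lemma stability (r : ℕ) (hr2 : 2 ≤ r) (η : ℝ) (hη : 0 < η) : ∃ ε > (0 : ℝ), ∃ N : ℕ,
    ∀ (V : Type) [DecidableEq V] [Fintype V], N ≤ Fintype.card V → ∀ H : Finset (Finset V),
    (∀ e ∈ H, e.card = r) → DeltaFree r H →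
    (1 / (r : ℝ)^r - ε) * (Fintype.card V : ℝ)^r ≤ H.card →
    ∃ U : Fin r → Finset V, ∀ p, Stab H U p η := by
  have hr0 : (0 : ℝ) < r := by exact_mod_cast (by omega : 0 < r)
  have hr1 : (1 : ℝ) ≤ r := by exact_mod_cast (by omega : 1 ≤ r)
  obtain ⟨R, hR⟩ : ∃ R : ℝ, R = (r : ℝ)^r := ⟨_, rfl⟩
  have hR1 : 1 ≤ R := by rw [hR]; exact one_le_pow₀ hr1
  have hR0 : 0 < R := by linarith
  obtain ⟨s, hs0, hs1, hs2, hsη⟩ : ∃ s : ℝ, 0 < s ∧ s ≤ 1 ∧ (r + 3) * s ≤ 1 / (2 * R) ∧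
      (r + 1) * s ≤ η := by
    have h1 : 1 / (2 * (r + 3) * R) ≤ 1 := by
      rw [div_le_one (by positivity)]
      nlinarith
    refine ⟨min (η / (r + 1)) (1 / (2 * (r + 3) * R)), by positivity, (min_le_right _ _).trans h1,
      ?_, ?_⟩
    · calc (r + 3) * min (η / (r + 1)) (1 / (2 * (r + 3) * R)) ≤ (r + 3) * (1 / (2 * (r + 3) * R)) := by
            gcongr; exact min_le_right _ _
        _ = _ := by field_simp
    · calc (r + 1) * min (η / (r + 1)) (1 / (2 * (r + 3) * R)) ≤ (r + 1) * (η / (r + 1)) := by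
            gcongr; exact min_le_left _ _
        _ = _ := by field_simp
  obtain ⟨δ, hδ⟩ : ∃ δ : ℝ, δ = s^2 / 2 := ⟨_, rfl⟩
  have hδ0 : 0 < δ := by rw [hδ]; positivity
  have hss : s^2 ≤ s := by nlinarith
  have hδ1 : δ ≤ 1 / 2 := by rw [hδ]; linarith
  obtain ⟨ε, hε⟩ : ∃ ε : ℝ, ε = δ^2 / (16 * R) := ⟨_, rfl⟩
  have hε0 : 0 < ε := by rw [hε]; positivity
  have hεR : ε * R = δ^2 / 16 := by rw [hε]; field_simp
  have hεδ : 2 * ε ≤ δ := by nlinarith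
  obtain ⟨N1, hN1⟩ := exists_nat_gt (2 * (r : ℝ)^(r + 2))
  obtain ⟨N2, hN2⟩ := exists_nat_gt ((2 * r + 1) * r / ε)
  refine ⟨ε, hε0, max N1 N2, ?_⟩
  intro V _ _ hN H hr hH hcard
  obtain ⟨n, hn'⟩ : ∃ n : ℕ, n = Fintype.card V := ⟨_, rfl⟩
  rw [← hn'] at hN
  have hn1 : 2 * (r : ℝ)^(r + 2) < n :=
    hN1.trans_le (by exact_mod_cast (le_max_left _ _).trans hN)
  have hn2 : (2 * r + 1) * r < ε * n := by
    rw [div_lt_iff₀ hε0] at hN2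
    have : (N2 : ℝ) ≤ n := by exact_mod_cast (le_max_right _ _).trans hN
    nlinarith
  have hn0 : (0 : ℝ) < n := lt_of_le_of_lt (by positivity) hn1
  have hn0' : 0 < n := by exact_mod_cast hn0
  have hnr : (n : ℝ) * (n : ℝ)^(r - 1) = (n : ℝ)^r := by
    rw [← pow_succ']; congr 1; omega
  haveI : Nonempty V := Fintype.card_pos_iff.1 (hn' ▸ hn0')
  obtain ⟨G, hGH, hG, hGc⟩ := exists_robust H hr
  rw [← hn'] at hGc hcard
  have hGc' : (1 / R - 2 * ε) * (n : ℝ)^r ≤ G.card := by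
    have h1 : (H.card : ℝ) ≤ G.card + (2 * r + 1) * (r * (n : ℝ)^(r - 1)) := by exact_mod_cast hGc
    have h2 : (2 * r + 1) * r * (n : ℝ)^(r - 1) ≤ ε * n * (n : ℝ)^(r - 1) :=
      mul_le_mul_of_nonneg_right hn2.le (by positivity)
    rw [mul_assoc ε, hnr] at h2
    rw [← hR] at hcard
    linarith
  obtain ⟨A, hA, hAs⟩ : ∃ A ∈ G, (1 - δ) * n < ∑ a ∈ A, ((NB G (A.erase a)).card : ℝ) := by
    by_contra hcon
    push Not at hcon
    have h1 := stab_count hr2 hH hr hGH hG δ hδ0.le (by rw [← hn']; exact hcon)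
    rw [← hn', ← hR] at h1
    have h2 : (1 / R - 2 * ε) * (n : ℝ)^r * ((1 + δ^2 / 4) * R) ≤ G.card * ((1 + δ^2 / 4) * R) :=
      mul_le_mul_of_nonneg_right hGc' (by positivity)
    have h3 : (1 / R - 2 * ε) * (n : ℝ)^r * ((1 + δ^2 / 4) * R) =
        ((1 - 2 * (ε * R)) * (1 + δ^2 / 4)) * (n : ℝ)^r := by
      field_simp
    rw [hεR] at h3
    have h4 : 1 < (1 - 2 * (δ^2 / 16)) * (1 + δ^2 / 4) := by
      have : 0 < δ^2 := by positivity
      have : δ^2 < 1 := by nlinarith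
      nlinarith
    have h5 : 1 * (n : ℝ)^r < ((1 - 2 * (δ^2 / 16)) * (1 + δ^2 / 4)) * (n : ℝ)^r :=
      mul_lt_mul_of_pos_right h4 (by positivity)
    linarith
  have cA := hr A (hGH hA)
  let q : Fin r ≃ {a // a ∈ A} := (A.equivFinOfCardEq cA).symm
  let U : Fin r → Finset V := fun k => NB G (A.erase (q k).1)
  have hd : ∀ k l, k ≠ l → Disjoint (U k) (U l) := by
    intro k l hkl
    apply U0_disj hH hr hGH hG hA
    intro h
    exact hkl (q.injective (Subtype.ext h))
  have hone : ∀ e ∈ G, ∀ k, ∀ u ∈ e, ∀ w ∈ e, u ∈ U k → w ∈ U k → u = w := by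
    intro e he k u hu w hw hu' hw'
    exact U0_one hH hr hGH hG hA (q k).2 he hu hw hu' hw'
  have hsum : ∑ k, (U k).card = ∑ a ∈ A, (NB G (A.erase a)).card := by
    rw [← sum_coe_sort A]
    exact Equiv.sum_comp q (fun a => (NB G (A.erase a.1)).card)
  have hsum' : (1 - δ) * n < ((∑ k, (U k).card : ℕ) : ℝ) := by
    rw [hsum]; push_cast; exact hAs
  have hbU : (univ.biUnion U).card = ∑ k, (U k).card :=
    card_biUnion (fun k _ l _ hkl => hd k l hkl)
  have hsumn : ∑ k, (U k).card ≤ n := by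
    rw [← hbU, hn']; exact card_le_univ _
  have hrest : ((univ.filter (fun v => ∀ k, v ∉ U k)).card : ℝ) ≤ δ * n := by
    have h1 : univ.filter (fun v => ∀ k, v ∉ U k) = (univ.biUnion U)ᶜ := by
      ext v; simp
    have h2 := card_compl_add_card (univ.biUnion U)
    rw [← h1, hbU, ← hn'] at h2
    have h3 : ((univ.filter (fun v => ∀ k, v ∉ U k)).card : ℝ) + ((∑ k, (U k).card : ℕ) : ℝ) = n := by
      exact_mod_cast h2
    linarith
  have hsub : G ⊆ (univ.filter (fun v => ∀ k, v ∉ U k)).biUnion (fun v => H.filter (fun e => {v} ⊆ e)) ∪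
      ((Fintype.piFinset U).filter (fun x => univ.image x ∈ H)).image (fun x => univ.image x) := by
    intro e he
    by_cases h : ∀ u ∈ e, ∃ k, u ∈ U k
    · apply mem_union_right
      obtain ⟨x, hx, hxe⟩ := cover U e (hr e (hGH he)) h (hone e he)
      rw [mem_image]
      refine ⟨x, mem_filter.2 ⟨hx, ?_⟩, hxe⟩
      rw [hxe]; exact hGH he
    · apply mem_union_left
      push Not at h
      obtain ⟨u, hu, hk⟩ := h
      rw [mem_biUnion]
      exact ⟨u, by simpa using hk, mem_filter.2 ⟨hGH he, by simpa using hu⟩⟩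
  have h1 := (card_le_card hsub).trans ((card_union_le _ _).trans
    (Nat.add_le_add (card_biUnion_le_card_mul _ _ (n^(r - 1)) (fun v _ => by
      have := card_filter_superset_le H hr {v}
      rwa [card_singleton, ← hn'] at this)) card_image_le))
  set Ht := (Fintype.piFinset U).filter (fun x => univ.image x ∈ H) with hHt
  have h2 : (G.card : ℝ) ≤ (univ.filter (fun v => ∀ k, v ∉ U k)).card * (n : ℝ)^(r - 1) + Ht.card := by
    exact_mod_cast h1
  have h3 : ((univ.filter (fun v => ∀ k, v ∉ U k)).card : ℝ) * (n : ℝ)^(r - 1) ≤ δ * (n : ℝ)^r := by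
    rw [← hnr, ← mul_assoc]
    exact mul_le_mul_of_nonneg_right hrest (by positivity)
  have h4 : (1 / R - s^2) * (n : ℝ)^r ≤ Ht.card := by
    have : (2 * ε + δ) * (n : ℝ)^r ≤ s^2 * (n : ℝ)^r :=
      mul_le_mul_of_nonneg_right (by linarith) (by positivity)
    linarith
  have h5 := card_filter_add_card_filter_not (s := Fintype.piFinset U) (fun x => univ.image x ∈ H)
  have h6 : (Ht.card : ℝ) + ((Fintype.piFinset U).filter (fun x => univ.image x ∉ H)).card =
      ((∏ k, (U k).card : ℕ) : ℝ) := by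
    rw [← Fintype.card_piFinset]; exact_mod_cast h5
  have h7 := amgm (by omega) (fun k => (U k).card) n hn0' hsumn
  rw [← hR] at h7
  obtain ⟨U', hU'⟩ := clean hr2 hH hr U s hs0 (by rw [← hR]; exact hs2) (by rw [← hn']; exact hn1) hd
    (by
      rw [← hn']; refine hrest.trans (mul_le_mul_of_nonneg_right (by linarith) hn0.le))
    (by
      rw [← hn']
      have : 1 / R * (n : ℝ)^r = (n : ℝ)^r / R := by ring
      linarith)
    (by
      rw [← hn', ← hR]
      have h8 : s^2 * (n : ℝ)^r ≤ s * (n : ℝ)^r := mul_le_mul_of_nonneg_right hss (by positivity)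
      have h9 : (0 : ℝ) ≤ ((Fintype.piFinset U).filter (fun x => univ.image x ∉ H)).card :=
        Nat.cast_nonneg _
      linarith)
  exact ⟨U', fun p => (hU' p).mono hsη⟩

end HMantel

namespace HMantel

open Finset

lemma prod_erase_le {r : ℕ} (y : Fin r → ℝ) (hy : ∀ i, 0 ≤ y i) (h : ∑ i, y i ≤ r)
    (hp : 0.99 ≤ ∏ i, y i) (j : Fin r) : ∏ l ∈ univ.erase j, y l ≤ 3 / 2 := by
  have h1 : ∏ l ∈ univ.erase j, y l ≤ ∏ l ∈ univ.erase j, Real.exp (y l - 1) := by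
    apply prod_le_prod (fun i _ => hy i)
    intro i _
    have := Real.add_one_le_exp (y i - 1); linarith
  rw [← Real.exp_sum, sum_sub_distrib, sum_const, card_erase_of_mem (mem_univ _), card_univ,
    Fintype.card_fin, nsmul_eq_mul, mul_one] at h1
  have hr : 1 ≤ r := by have := j.isLt; omega
  rw [← add_sum_erase _ _ (mem_univ j)] at h
  rw [← mul_prod_erase _ _ (mem_univ j)] at hp
  push_cast [hr] at h1
  generalize ∏ l ∈ univ.erase j, y l = q at *
  generalize ∑ l ∈ univ.erase j, y l = t at *
  have h2 : q ≤ Real.exp (1 - y j) := h1.trans (Real.exp_le_exp.2 (by linarith))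
  have h3 := exp_bound (y j) (hy j)
  have h4 : y j * q ≤ Real.exp (-(1 - √(y j))^2) := by
    calc y j * q ≤ y j * Real.exp (1 - y j) := by
          exact mul_le_mul_of_nonneg_left h2 (hy j)
      _ ≤ Real.exp (y j - 1 - (1 - √(y j))^2) * Real.exp (1 - y j) := by gcongr
      _ = _ := by rw [← Real.exp_add]; ring_nf
  have hsq : √(y j) ^ 2 = y j := Real.sq_sqrt (hy j)
  have hsn := Real.sqrt_nonneg (y j)
  generalize √(y j) = w at *
  have h5 : (1 - w)^2 ≤ 0.0102 := by
    by_contra hc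
    push Not at hc
    have h6 := Real.add_one_le_exp ((1 - w)^2)
    have h7 : Real.exp (-(1 - w)^2) * Real.exp ((1 - w)^2) = 1 := by
      rw [← Real.exp_add]; simp
    have h8 : 0.99 ≤ Real.exp (-(1 - w)^2) := hp.trans h4
    nlinarith [Real.exp_pos ((1 - w)^2)]
  have h6 : 0.89 ≤ w := by nlinarith
  have h7 : 0.79 ≤ y j := by nlinarith
  by_contra hq
  push Not at hq
  have h8 : 3 / 2 < Real.exp (1 - y j) := hq.trans_le h2
  have h9 : Real.exp (1 - y j) * Real.exp (y j - 1) = 1 := by rw [← Real.exp_add]; simp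
  have h10 := Real.add_one_le_exp (y j - 1)
  nlinarith [Real.exp_pos (1 - y j)]

lemma Stab.sum_le {V : Type} [DecidableEq V] [Fintype V] {r : ℕ} {H : Finset (Finset V)}
    {U : Fin r → Finset V} {p : V} {η : ℝ} (h : Stab H U p η) :
    ∑ k, (U k).card ≤ Fintype.card V := by
  rw [← card_biUnion (fun k _ l _ hkl => h.disj k l hkl)]
  exact card_le_univ _

lemma Stab.DD_le {V : Type} [DecidableEq V] [Fintype V] {r : ℕ} {H : Finset (Finset V)}
    {U : Fin r → Finset V} {p : V} {η : ℝ} (h : Stab H U p η)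
    (hn : 0 < Fintype.card V) (hη : η ≤ 1 / (100 * (r : ℝ)^r)) (j : Fin r) :
    ((DD U p j).card : ℝ) * (r : ℝ)^(r - 1) ≤ 3 / 2 * (Fintype.card V : ℝ)^(r - 1) := by
  have hr : 1 ≤ r := by have := j.isLt; omega
  have hr0 : (0 : ℝ) < r := by exact_mod_cast hr
  have hs := h.sum_le
  have hp := h.prod
  obtain ⟨n, hn'⟩ : ∃ n : ℕ, n = Fintype.card V := ⟨_, rfl⟩
  rw [← hn'] at hn hs hp ⊢
  have hn0 : (0 : ℝ) < n := by exact_mod_cast hn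
  have h1 := prod_erase_le (fun k => (r : ℝ) / n * (U k).card) (fun k => by positivity) (by
    rw [← mul_sum]
    have h' : ∑ i, ((U i).card : ℝ) ≤ n := by exact_mod_cast hs
    calc (r : ℝ) / n * ∑ i, ((U i).card : ℝ) ≤ r / n * n := by gcongr
      _ = r := by field_simp) (by
    rw [prod_mul_distrib, prod_const, card_univ, Fintype.card_fin, div_pow]
    push_cast at hp
    generalize ∏ k, ((U k).card : ℝ) = q at *
    have h2 : 0.99 / (r : ℝ)^r * (n : ℝ)^r ≤ q := by
      refine le_trans (mul_le_mul_of_nonneg_right ?_ (by positivity)) hp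
      have : 0.99 / (r : ℝ)^r = 1 / (r : ℝ)^r - 1 / (100 * (r : ℝ)^r) := by field_simp; norm_num
      linarith
    calc (0.99 : ℝ) = (r : ℝ)^r / (n : ℝ)^r * (0.99 / (r : ℝ)^r * (n : ℝ)^r) := by field_simp
      _ ≤ _ := mul_le_mul_of_nonneg_left h2 (by positivity)) j
  rw [prod_mul_distrib, prod_const, card_erase_of_mem (mem_univ _), card_univ, Fintype.card_fin,
    div_pow] at h1
  rw [card_DD]
  push_cast
  generalize ∏ l ∈ univ.erase j, ((U l).card : ℝ) = q at *
  rw [div_mul_eq_mul_div, div_le_iff₀ (by positivity)] at h1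
  linarith

lemma deg_bound {V : Type} [DecidableEq V] [Fintype V] {r : ℕ} {H : Finset (Finset V)}
    (hr2 : 2 ≤ r) (hr : ∀ e ∈ H, e.card = r)
    {U : Fin r → Finset V} {p : V} {η : ℝ} (h : Stab H U p η) (v : V) (J : Finset (Fin r))
    (hJ : ∀ e ∈ H, v ∈ e → (∀ u ∈ e.erase v, ∃ k, u ∈ U k) →
      ∃ j ∈ J, ∀ u ∈ e.erase v, u ∉ U j) :
    ((H.filter (fun e => v ∈ e)).card : ℝ) ≤
      η * (Fintype.card V : ℝ)^(r - 1) + ∑ j ∈ J, ((LL H U p j v).card : ℝ) := by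
  set W := univ.filter (fun v => ∀ k, v ∉ U k) with hW
  have hsub : H.filter (fun e => v ∈ e) ⊆
      (W.erase v).biUnion (fun w => H.filter (fun e => {v, w} ⊆ e)) ∪
      J.biUnion (fun j => (LL H U p j v).image (fun x => univ.image (Function.update x j v))) := by
    intro e he
    rw [mem_filter] at he
    obtain ⟨he, hv⟩ := he
    by_cases hc : ∀ u ∈ e.erase v, ∃ k, u ∈ U k
    · apply mem_union_right
      obtain ⟨j, hj, hj'⟩ := hJ e he hv hc
      obtain ⟨x, hx, hxe⟩ := cover (Function.update U j {v}) e (hr e he) (by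
        intro u hu
        by_cases huv : u = v
        · exact ⟨j, by simp [huv]⟩
        · have hu' := mem_erase.2 ⟨huv, hu⟩
          obtain ⟨k, hk⟩ := hc u hu'
          refine ⟨k, ?_⟩
          rw [Function.update_of_ne]
          · exact hk
          · rintro rfl; exact hj' u hu' hk) (by
        intro k u hu w hw huk hwk
        by_cases hkj : k = j
        · subst hkj
          simp only [Function.update_self, mem_singleton] at huk hwk
          rw [huk, hwk]
        · rw [Function.update_of_ne hkj] at huk hwk
          exact h.one e he k u hu w hw huk hwk)
      have hx2 : x ∈ DD U v j := hx
      rw [mem_DD] at hx2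
      have hupd : Function.update (Function.update x j p) j v = x := by
        rw [Function.update_idem, ← hx2.1, Function.update_eq_self]
      rw [mem_biUnion]
      refine ⟨j, hj, mem_image.2 ⟨Function.update x j p, ?_, ?_⟩⟩
      · rw [LL, mem_filter, mem_DD, hupd, hxe]
        refine ⟨⟨by simp, fun l hl => ?_⟩, he⟩
        rw [Function.update_of_ne hl]; exact hx2.2 l hl
      · rw [hupd, hxe]
    · apply mem_union_left
      push Not at hc
      obtain ⟨w, hw, hk⟩ := hc
      rw [mem_erase] at hw
      rw [mem_biUnion]
      refine ⟨w, by simpa [hW] using ⟨hw.1, hk⟩, mem_filter.2 ⟨he, ?_⟩⟩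
      intro u hu
      simp only [mem_insert, mem_singleton] at hu
      rcases hu with rfl | rfl
      · exact hv
      · exact hw.2
  have h1 := (card_le_card hsub).trans ((card_union_le _ _).trans
    (Nat.add_le_add (card_biUnion_le_card_mul _ _ ((Fintype.card V)^(r - 2)) (fun w hw => by
      have h2 := card_filter_superset_le H hr {v, w}
      rwa [card_pair (ne_of_mem_erase hw).symm] at h2))
      (card_biUnion_le.trans (sum_le_sum fun j _ => card_image_le))))
  have h2 : ((H.filter (fun e => v ∈ e)).card : ℝ) ≤
    (W.erase v).card * (Fintype.card V : ℝ)^(r - 2) + ∑ j ∈ J, ((LL H U p j v).card : ℝ) := by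
    exact_mod_cast h1
  have h3 : ((W.erase v).card : ℝ) ≤ η * Fintype.card V :=
    le_trans (by exact_mod_cast card_le_card (erase_subset _ _)) h.rest
  have h4 : ((W.erase v).card : ℝ) * (Fintype.card V : ℝ)^(r - 2) ≤
      η * (Fintype.card V : ℝ)^(r - 1) := by
    have : (Fintype.card V : ℝ)^(r - 1) = Fintype.card V * (Fintype.card V : ℝ)^(r - 2) := by
      rw [← pow_succ']; congr 1; omega
    rw [this, ← mul_assoc]
    exact mul_le_mul_of_nonneg_right h3 (by positivity)
  linarith

lemma part1 {V : Type} [DecidableEq V] [Fintype V] {r : ℕ} {H : Finset (Finset V)}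
    (hr2 : 2 ≤ r) (hH : DeltaFree r H) (hr : ∀ e ∈ H, e.card = r)
    {U : Fin r → Finset V} {η κ : ℝ} (hS : ∀ p, Stab H U p η) (hκ : κ = 1 / (100 * (r : ℝ)^r))
    (hη : η ≤ κ) (hn : (r : ℝ) * r ≤ κ * Fintype.card V)
    (hdeg : ∀ v, (100 * r - 1) * κ * (Fintype.card V : ℝ)^(r - 1) ≤
      ((H.filter (fun e => v ∈ e)).card : ℝ)) : RPartite r H := by
  classical
  have hr0 : (0 : ℝ) < r := by exact_mod_cast (by omega : 0 < r)
  have hr2' : (2 : ℝ) ≤ r := by exact_mod_cast hr2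
  have hκ0 : 0 < κ := by rw [hκ]; positivity
  have hDD := fun p => (hS p).DD_le
  have hdb := fun p => deg_bound hr2 hr (hS p)
  have htyp := fun p => (hS p).typ
  have hcol := fun p k C hC u v hu hv huv => @collision V _ _ r H hr2 hH hr U p k C hC u v hu hv huv
  obtain ⟨n, hn'⟩ : ∃ n : ℕ, n = Fintype.card V := ⟨_, rfl⟩
  simp only [← hn'] at hn hdeg hDD hdb htyp hcol
  have hn0 : (0 : ℝ) < n := by
    by_contra hc
    have : (0 : ℝ) < r * r := by positivity
    nlinarith
  have hνpos : (0 : ℝ) < (n : ℝ)^(r - 1) := by positivity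
  have hκr : κ * (100 * r) * (r : ℝ)^(r - 1) = 1 := by
    have : (r : ℝ)^r = r * (r : ℝ)^(r - 1) := by rw [← pow_succ']; congr 1; omega
    rw [hκ, this]; field_simp
  have hDD' : ∀ p j, ((DD U p j).card : ℝ) ≤ 150 * r * κ * (n : ℝ)^(r - 1) := by
    intro p j
    have h1 := hDD p (by exact_mod_cast hn0) (by rw [← hκ]; exact hη) j
    have h2 := mul_le_mul_of_nonneg_left h1 (by positivity : 0 ≤ κ * (100 * r))
    have h3 : κ * (100 * r) * (((DD U p j).card : ℝ) * (r : ℝ)^(r - 1)) = (DD U p j).card := by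
      calc _ = κ * (100 * r) * (r : ℝ)^(r - 1) * (DD U p j).card := by ring
        _ = _ := by rw [hκr, one_mul]
    rw [h3] at h2
    linarith
  have hn2 : (r : ℝ) * (r * (n : ℝ)^(r - 2)) ≤ κ * (n : ℝ)^(r - 1) := by
    have : (n : ℝ)^(r - 1) = n * (n : ℝ)^(r - 2) := by
      rw [← pow_succ']; congr 1; omega
    rw [this, ← mul_assoc, ← mul_assoc]
    exact mul_le_mul_of_nonneg_right hn (by positivity)
  obtain ⟨ν, hν⟩ : ∃ ν, ν = (n : ℝ)^(r - 1) := ⟨_, rfl⟩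
  rw [← hν] at hνpos hn2
  simp only [← hν] at hdeg hDD' hdb htyp
  have hην : η * ν ≤ κ * ν := mul_le_mul_of_nonneg_right hη hνpos.le
  have hκν : 0 < κ * ν := by positivity
  have hcol' : ∀ p k, ∀ C ∈ H, ∀ u v, u ∈ C → v ∈ C → u ≠ v →
      ((DD U p k).card : ℝ) + κ * ν < (LL H U p k u).card + (LL H U p k v).card → False := by
    intro p k C hC u v hu hv huv hlt
    refine hcol p k C hC u v hu hv huv ?_
    have : ((DD U p k).card : ℝ) + r * (r * (n : ℝ)^(r - 2)) < (LL H U p k u).card + (LL H U p k v).card := by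
      linarith
    exact_mod_cast this
  have key : ∀ v, ∃ j, ∀ p, (100 * r - 2) * (κ * ν) ≤ ((LL H U p j v).card : ℝ) := by
    intro v
    have h1 := hdb v v univ (by
      intro e he hv _
      by_contra hcon
      push Not at hcon
      choose g hg hg' using fun j => hcon j (mem_univ j)
      have hinj : Function.Injective g := by
        intro k l hkl
        by_contra hne
        exact Finset.disjoint_left.1 ((hS v).disj k l hne) (hg' k) (hkl ▸ hg' l)
      have h2 : (univ.image g).card ≤ (e.erase v).card := by
        apply card_le_card
        intro w hw
        obtain ⟨k, _, rfl⟩ := mem_image.1 hw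
        exact hg k
      rw [card_image_of_injective _ hinj, card_univ, Fintype.card_fin, card_erase_of_mem hv, hr e he] at h2
      omega)
    have h2 := hdeg v
    obtain ⟨j, hj⟩ : ∃ j, 3 * (κ * ν) ≤ ((LL H U v j v).card : ℝ) := by
      by_contra hcon
      push Not at hcon
      have h3 : ∑ j, ((LL H U v j v).card : ℝ) ≤ ∑ j : Fin r, 3 * (κ * ν) :=
        sum_le_sum fun j _ => (hcon j).le
      rw [sum_const, card_univ, Fintype.card_fin, nsmul_eq_mul] at h3
      nlinarith
    refine ⟨j, fun p => ?_⟩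
    have h3 := hdb p v {j} (by
      intro e he hv _
      refine ⟨j, mem_singleton_self _, fun u hu huj => ?_⟩
      rw [mem_erase] at hu
      refine hcol' v j e he u v hu.2 hv hu.1 ?_
      have h4 := htyp v j u huj
      linarith)
    rw [sum_singleton] at h3
    nlinarith
  choose P hP using key
  refine ⟨P, fun e he k => ?_⟩
  have hinj : Set.InjOn P (e : Set V) := by
    intro u hu v hv huv
    by_contra hne
    refine hcol' u (P u) e he u v hu hv hne ?_
    have h1 := hP u u
    have h2 := hP v u
    rw [← huv] at h2
    have h3 := hDD' u (P u)
    nlinarith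
  have himg : e.image P = univ := by
    apply eq_univ_of_card
    rw [card_image_of_injOn hinj, hr e he, Fintype.card_fin]
  rw [card_eq_one]
  have hk : k ∈ e.image P := by rw [himg]; simp
  obtain ⟨u, hu, huk⟩ := mem_image.1 hk
  refine ⟨u, ?_⟩
  ext w
  simp only [mem_filter, mem_singleton]
  constructor
  · rintro ⟨hw, hwk⟩
    exact hinj hw hu (hwk.trans huk.symm)
  · rintro rfl; exact ⟨hu, huk⟩

end HMantel

namespace HMantel

open Finset

lemma deltaFree_of {r : ℕ} (hr2 : 2 ≤ r) {V : Type*} [DecidableEq V] (H : Finset (Finset V))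
    (h : ∀ A ∈ H, ∀ B ∈ H, ∀ C ∈ H, ∀ z, z ∉ A → 1 ≤ (A ∩ B).card → (A ∩ B).card ≤ (r + 1) / 2 →
      A ∩ C = A \ B → B ∩ C = {z} → False) : DeltaFree r H := by
  rintro ⟨i, hi1, hi2, f, hf, hA, hB, hC⟩
  have hir : i + 1 ≤ r := by omega
  have hf' : ∀ s : Finset ℕ, s ⊆ Icc 1 (2 * r - 1) → Set.InjOn f (s : Set ℕ) := by
    intro s hs
    apply hf.mono
    intro x hx
    have := hs hx
    rw [mem_Icc] at this
    exact this
  set IA := Icc 1 r with hIA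
  set IB := Icc 1 i ∪ Icc (r + 1) (2 * r - i) with hIB
  set IC := Icc (i + 1) r ∪ insert (r + 1) (Icc (2 * r - i + 1) (2 * r - 1)) with hIC
  have sA : IA ⊆ Icc 1 (2 * r - 1) := by
    intro x; simp only [hIA, mem_Icc]; omega
  have sB : IB ⊆ Icc 1 (2 * r - 1) := by
    intro x; simp only [hIB, mem_union, mem_Icc]; omega
  have sC : IC ⊆ Icc 1 (2 * r - 1) := by
    intro x; simp only [hIC, mem_union, mem_insert, mem_Icc]; omega
  have mem_im : ∀ s : Finset ℕ, s ⊆ Icc 1 (2 * r - 1) → ∀ m ∈ Icc 1 (2 * r - 1),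
      (f m ∈ s.image f ↔ m ∈ s) := by
    intro s hs m hm
    constructor
    · intro hx
      obtain ⟨m', hm', he⟩ := mem_image.1 hx
      have h1 := hs hm'
      rw [mem_Icc] at h1 hm
      rw [← hf h1 hm he]; exact hm'
    · exact mem_image_of_mem f
  have hAB : IA.image f ∩ IB.image f = (Icc 1 i).image f := by
    ext w
    constructor
    · intro hw
      rw [mem_inter] at hw
      obtain ⟨m, hm, rfl⟩ := mem_image.1 hw.1
      have h2 := (mem_im IB sB m (sA hm)).1 hw.2
      apply mem_image_of_mem
      simp only [hIA, hIB, mem_union, mem_Icc] at hm h2 ⊢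
      omega
    · intro hw
      obtain ⟨m, hm, rfl⟩ := mem_image.1 hw
      rw [mem_inter]
      constructor <;> apply mem_image_of_mem <;> simp only [hIA, hIB, mem_union, mem_Icc] at hm ⊢ <;> omega
  have hcard : ((Icc 1 i).image f).card = i := by
    rw [card_image_of_injOn (hf' _ (by intro x; simp only [mem_Icc]; omega))]; simp
  refine h _ hA _ hB _ hC (f (r + 1)) ?_ ?_ ?_ ?_ ?_
  · rw [mem_im IA sA _ (by rw [mem_Icc]; omega)]
    simp [hIA]
  · rw [hAB, hcard]; exact hi1
  · rw [hAB, hcard]; exact hi2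
  · ext w
    rw [mem_inter, mem_sdiff]
    apply and_congr_right
    intro hw
    obtain ⟨m, hm, rfl⟩ := mem_image.1 hw
    rw [mem_im IB sB m (sA hm), mem_im IC sC m (sA hm)]
    simp only [hIA, hIB, hIC, mem_union, mem_insert, mem_Icc] at hm ⊢
    omega
  · ext w
    rw [mem_inter, mem_singleton]
    constructor
    · rintro ⟨h1, h2⟩
      obtain ⟨m, hm, rfl⟩ := mem_image.1 h1
      rw [mem_im IC sC m (sB hm)] at h2
      congr 1
      simp only [hIB, hIC, mem_union, mem_insert, mem_Icc] at hm h2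
      omega
    · rintro rfl
      constructor
      · apply mem_image_of_mem
        simp only [hIB, mem_union, mem_Icc]; omega
      · apply mem_image_of_mem
        rw [hIC, mem_union, mem_insert]
        exact Or.inr (Or.inl rfl)

lemma deltaFree_of_partite {r : ℕ} (hr2 : 2 ≤ r) {V : Type*} [DecidableEq V] {H : Finset (Finset V)}
    (P : V → Fin r) (hP : ∀ e ∈ H, ∀ k : Fin r, (e.filter (fun u => P u = k)).card = 1) :
    DeltaFree r H := by
  apply deltaFree_of hr2
  intro A hA B hB C hC z hz _ _ h3 h4
  have hzBC : z ∈ B ∩ C := by rw [h4]; simp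
  rw [mem_inter] at hzBC
  have heq : ∀ e ∈ H, ∀ a ∈ e, ∀ b ∈ e, P a = P b → a = b := by
    intro e he a ha b hb hab
    exact card_le_one.1 (hP e he (P a)).le a (mem_filter.2 ⟨ha, rfl⟩) b
      (mem_filter.2 ⟨hb, hab.symm⟩)
  obtain ⟨a, ha⟩ := card_eq_one.1 (hP A hA (P z))
  have ha' : a ∈ A.filter (fun u => P u = P z) := by rw [ha]; simp
  rw [mem_filter] at ha'
  apply hz
  by_cases haB : a ∈ B
  · rw [← heq B hB a haB z hzBC.1 ha'.2]; exact ha'.1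
  · have : a ∈ A ∩ C := by rw [h3]; exact mem_sdiff.2 ⟨ha'.1, haB⟩
    rw [← heq C hC a (mem_inter.1 this).2 z hzBC.2 ha'.2]; exact ha'.1

/-- Cloning lemma. -/
lemma clone {r : ℕ} (hr2 : 2 ≤ r) {V : Type*} [DecidableEq V] {H : Finset (Finset V)}
    (hH : DeltaFree r H) (hr : ∀ e ∈ H, e.card = r) (U : Fin r → Finset V)
    (hone : ∀ e ∈ H, ∀ k, ∀ u ∈ e, ∀ w ∈ e, u ∈ U k → w ∈ U k → u = w)
    (v : V) (j : Fin r) (R : Finset V) (hR : 3 * r < R.card) (N : Finset (Finset V))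
    (hN1 : ∀ m ∈ N, v ∉ m) (hN2 : ∀ m ∈ N, ∀ u ∈ R, insert u m ∈ H)
    (hN3 : ∀ m ∈ N, ∀ w ∈ m, ∃ k, k ≠ j ∧ w ∈ U k)
    (hN4 : ∀ m ∈ N, ∀ k, k ≠ j → ∃ w ∈ m, w ∈ U k)
    (hN5 : ∀ m ∈ N, m.card = r - 1) :
    DeltaFree r (H.filter (fun e => v ∉ e) ∪ N.image (fun m => insert v m)) := by
  set K := H.filter (fun e => v ∉ e) ∪ N.image (fun m => insert v m) with hK
  have hold : ∀ e ∈ K, v ∉ e → e ∈ H := by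
    intro e he hv
    rw [hK, mem_union, mem_filter, mem_image] at he
    rcases he with h | ⟨m, _, rfl⟩
    · exact h.1
    · exact absurd (mem_insert_self _ _) hv
  have hnew : ∀ e ∈ K, v ∈ e → ∃ m ∈ N, insert v m = e := by
    intro e he hv
    rw [hK, mem_union, mem_filter, mem_image] at he
    rcases he with h | h
    · exact absurd hv h.2
    · exact h
  have hKr : ∀ e ∈ K, e.card = r := by
    intro e he
    by_cases hv : v ∈ e
    · obtain ⟨m, hm, rfl⟩ := hnew e he hv
      rw [card_insert_of_notMem (hN1 m hm), hN5 m hm]; omega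
    · exact hr e (hold e he hv)
  obtain ⟨u0, hu0⟩ : R.Nonempty := card_pos.1 (by omega)
  have hone' : ∀ e ∈ K, ∀ k, ∀ u ∈ e, ∀ w ∈ e, u ≠ v → w ≠ v → u ∈ U k → w ∈ U k → u = w := by
    intro e he k u hu w hw huv hwv huk hwk
    by_cases hv : v ∈ e
    · obtain ⟨m, hm, rfl⟩ := hnew e he hv
      rw [mem_insert] at hu hw
      exact hone _ (hN2 m hm u0 hu0) k u (mem_insert_of_mem (hu.resolve_left huv)) w
        (mem_insert_of_mem (hw.resolve_left hwv)) huk hwk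
    · exact hone e (hold e he hv) k u hu w hw huk hwk
  apply deltaFree_of hr2
  intro A hA B hB C hC z hz h1 h2 h3 h4
  have cA := hKr A hA
  have cB := hKr B hB
  have cC := hKr C hC
  have hzBC : z ∈ B ∩ C := by rw [h4]; simp
  rw [mem_inter] at hzBC
  have hABC : ∀ a ∈ A, a ∈ B ∨ a ∈ C := by
    intro a ha
    by_cases haB : a ∈ B
    · exact Or.inl haB
    · have : a ∈ A ∩ C := by rw [h3]; exact mem_sdiff.2 ⟨ha, haB⟩
      exact Or.inr (mem_inter.1 this).2
  have hcl : ∀ S ∈ K, v ∈ S → ∀ a ∈ S, a ≠ v → ∃ k, k ≠ j ∧ a ∈ U k := by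
    intro S hS hv a ha hav
    obtain ⟨m, hm, rfl⟩ := hnew S hS hv
    exact hN3 m hm a ((mem_insert.1 ha).resolve_left hav)
  by_cases hvA : v ∈ A
  · have hzv : z ≠ v := by rintro rfl; exact hz hvA
    obtain ⟨k, hkj, hzk⟩ : ∃ k, k ≠ j ∧ z ∈ U k := by
      rcases hABC v hvA with h | h
      · exact hcl B hB h z hzBC.1 hzv
      · exact hcl C hC h z hzBC.2 hzv
    obtain ⟨m, hm, rfl⟩ := hnew A hA hvA
    obtain ⟨a, ha, hak⟩ := hN4 m hm k hkj
    have hav : a ≠ v := by rintro rfl; exact hN1 m hm ha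
    have haA : a ∈ insert v m := mem_insert_of_mem ha
    apply hz
    rcases hABC a haA with h | h
    · rw [← hone' B hB k a h z hzBC.1 hav hzv hak hzk]; exact haA
    · rw [← hone' C hC k a h z hzBC.2 hav hzv hak hzk]; exact haA
  have hAH := hold A hA hvA
  by_cases hzv : z = v
  · subst hzv
    have hc : ∀ a ∈ A, ∃ k, k ≠ j ∧ a ∈ U k := by
      intro a ha
      have haz : a ≠ z := by rintro rfl; exact hz ha
      rcases hABC a ha with h | h
      · exact hcl B hB hzBC.1 a h haz
      · exact hcl C hC hzBC.2 a h haz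
    choose c hc1 hc2 using hc
    have hle : (univ : Finset {a // a ∈ A}).card ≤ ((univ : Finset (Fin r)).erase j).card := by
      apply card_le_card_of_injOn (fun a => c a.1 a.2)
      · intro a _
        simp [hc1]
      · intro a _ b _ hab
        apply Subtype.ext
        refine hone A hAH (c a.1 a.2) a.1 a.2 b.1 b.2 (hc2 _ _) ?_
        have : c a.1 a.2 = c b.1 b.2 := hab
        rw [this]; exact hc2 _ _
    rw [card_erase_of_mem (mem_univ _), card_univ, card_univ, Fintype.card_fin, Fintype.card_coe, cA] at hle
    omega
  have hex : ∃ u ∈ R, u ∉ A ∪ B ∪ C := by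
    apply exists_mem_notMem_of_card_lt_card
    have h5 := card_union_le (A ∪ B) C
    have h6 := card_union_le A B
    omega
  obtain ⟨u, huR, hu⟩ := hex
  simp only [mem_union, not_or] at hu
  obtain ⟨⟨huA, huB⟩, huC⟩ := hu
  by_cases hvB : v ∈ B
  · have hvC : v ∉ C := by
      intro hvC
      have : v ∈ B ∩ C := mem_inter.2 ⟨hvB, hvC⟩
      rw [h4, mem_singleton] at this
      exact hzv this.symm
    obtain ⟨m, hm, rfl⟩ := hnew B hB hvB
    have hi : A ∩ insert u m = A ∩ insert v m := by
      rw [inter_insert_of_notMem huA, inter_insert_of_notMem hvA]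
    refine mkT hH hAH (hN2 m hm u huR) (hold C hC hvC) cA (hr _ (hN2 m hm u huR)) cC hz ?_ ?_ ?_ ?_
    · rw [hi]; exact h1
    · rw [hi]; exact h2
    · rw [h3, ← sdiff_inter_self_left, ← hi, sdiff_inter_self_left]
    · rw [insert_inter_of_notMem huC, ← h4, insert_inter_of_notMem hvC]
  have hBH := hold B hB hvB
  by_cases hvC : v ∈ C
  · obtain ⟨m, hm, rfl⟩ := hnew C hC hvC
    refine mkT hH hAH hBH (hN2 m hm u huR) cA cB (hr _ (hN2 m hm u huR)) hz h1 h2 ?_ ?_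
    · rw [inter_insert_of_notMem huA, ← h3, inter_insert_of_notMem hvA]
    · rw [inter_insert_of_notMem huB, ← h4, inter_insert_of_notMem hvB]
  exact mkT hH hAH hBH (hold C hC hvC) cA cB cC hz h1 h2 h3 h4

end HMantel

namespace HMantel

open Finset

lemma extremal_deg {V : Type} [DecidableEq V] [Fintype V] {r : ℕ} {H : Finset (Finset V)}
    (hr2 : 2 ≤ r) (hH : DeltaFree r H) (hr : ∀ e ∈ H, e.card = r)
    {U : Fin r → Finset V} {η κ : ℝ} (hS : ∀ p, Stab H U p η) (hκ : κ = 1 / (100 * (r : ℝ)^r))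
    (hη : η = κ / (10 * r)) (hn : (r : ℝ) * r ≤ κ * Fintype.card V)
    (hmax : ∀ H' : Finset (Finset V), (∀ e ∈ H', e.card = r) → DeltaFree r H' → H'.card ≤ H.card)
    (v : V) : (100 * r - 1) * κ * (Fintype.card V : ℝ)^(r - 1) ≤
      ((H.filter (fun e => v ∈ e)).card : ℝ) := by
  classical
  have hr0 : (0 : ℝ) < r := by exact_mod_cast (by omega : 0 < r)
  have hr2' : (2 : ℝ) ≤ r := by exact_mod_cast hr2
  have hκ0 : 0 < κ := by rw [hκ]; positivity
  have hη0 : 0 < η := by rw [hη]; positivity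
  have hηr : η * (10 * r) = κ := by rw [hη]; field_simp
  have hsum := (hS v).sum_le
  have hprod := (hS v).prod
  have htyp := (hS v).typ
  have hdisj := (hS v).disj
  have hfix := fun k (S : Finset (Fin r → V)) => card_fix_one k v S
  have hhits := fun k (S : Finset (Fin r → V)) => card_hits k v {v} S
  obtain ⟨n, hn'⟩ : ∃ n : ℕ, n = Fintype.card V := ⟨_, rfl⟩
  simp only [← hn'] at hn hsum hprod htyp hfix hhits ⊢
  have hn0 : (0 : ℝ) < n := by
    by_contra hc
    have : (0 : ℝ) < r * r := by positivity
    nlinarith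
  have hnr : (n : ℝ)^r = n * (n : ℝ)^(r - 1) := by
    rw [← pow_succ']; congr 1; omega
  have hνpos : (0 : ℝ) < (n : ℝ)^(r - 1) := by positivity
  have hκR : 1 / (r : ℝ)^r = 100 * κ := by rw [hκ]; field_simp
  rw [hκR, hnr] at hprod
  -- choice of the part
  obtain ⟨j, hj⟩ : ∃ j, ((U j).card : ℝ) * r ≤ n := by
    by_contra hcon
    push Not at hcon
    have h1 : ∑ j : Fin r, (n : ℝ) < ∑ j, ((U j).card : ℝ) * r := by
      apply sum_lt_sum_of_nonempty ⟨⟨0, by omega⟩, mem_univ _⟩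
      intro j _; exact hcon j
    rw [sum_const, card_univ, Fintype.card_fin, nsmul_eq_mul, ← sum_mul] at h1
    have h2 : ∑ j, ((U j).card : ℝ) ≤ n := by exact_mod_cast hsum
    nlinarith
  have hDDn : ((DD U v j).card : ℝ) ≤ (n : ℝ)^(r - 1) := by
    exact_mod_cast hfix j (DD U v j) (fun x hx => (mem_DD.1 hx).1)
  rw [← card_DD_mul U v j] at hprod
  push_cast at hprod
  have hUj : 3 * r + 1 ≤ ((U j).erase v).card := by
    have h1 : (100 * κ - η) * n ≤ (U j).card := by
      have h2 : ((U j).card : ℝ) * (DD U v j).card ≤ (U j).card * (n : ℝ)^(r - 1) :=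
        mul_le_mul_of_nonneg_left hDDn (by positivity)
      have h3 := hprod.trans h2
      rw [← mul_assoc] at h3
      exact le_of_mul_le_mul_right h3 hνpos
    have h2 : η ≤ κ := by nlinarith
    have h3 : 99 * (κ * n) ≤ (U j).card := by nlinarith
    have h4 : (3 * r + 2 : ℝ) ≤ (U j).card := by nlinarith
    have h5 : 3 * r + 2 ≤ (U j).card := by exact_mod_cast h4
    have := pred_card_le_card_erase (s := U j) (a := v)
    omega
  obtain ⟨R, hRs, hRc⟩ := exists_subset_card_eq hUj
  have hDDlow : (100 * κ - η) * r * (n : ℝ)^(r - 1) ≤ (DD U v j).card := by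
    have h2 : ((U j).card : ℝ) * r * (DD U v j).card ≤ n * (DD U v j).card :=
      mul_le_mul_of_nonneg_right hj (by positivity)
    have h3 : (n : ℝ) * ((100 * κ - η) * r * (n : ℝ)^(r - 1)) ≤ n * (DD U v j).card := by
      nlinarith
    exact le_of_mul_le_mul_left h3 hn0
  let X := (DD U v j).filter (fun x => (∀ u ∈ R, univ.image (Function.update x j u) ∈ H) ∧
    ∀ l, l ≠ j → x l ≠ v)
  have hXc : ((DD U v j).card : ℝ) ≤ X.card + ((3 * r + 1) * (η * (n : ℝ)^(r - 1)) +
      r * (n : ℝ)^(r - 2)) := by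
    have hsub : DD U v j ⊆ X ∪ (R.biUnion (fun u => DD U v j \ LL H U v j u) ∪
        (DD U v j).filter (fun x => ∃ l, l ≠ j ∧ x l ∈ ({v} : Finset V))) := by
      intro x hx
      by_cases h1 : ∃ l, l ≠ j ∧ x l ∈ ({v} : Finset V)
      · exact mem_union_right _ (mem_union_right _ (mem_filter.2 ⟨hx, h1⟩))
      by_cases h2 : ∀ u ∈ R, univ.image (Function.update x j u) ∈ H
      · apply mem_union_left
        refine mem_filter.2 ⟨hx, h2, fun l hl hv => h1 ⟨l, hl, by simp [hv]⟩⟩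
      · push Not at h2
        obtain ⟨u, hu, huH⟩ := h2
        apply mem_union_right
        apply mem_union_left
        rw [mem_biUnion]
        refine ⟨u, hu, mem_sdiff.2 ⟨hx, fun h => huH (mem_filter.1 h).2⟩⟩
    have h1 := (card_le_card hsub).trans ((card_union_le _ _).trans (Nat.add_le_add_left
      ((card_union_le _ _).trans (Nat.add_le_add card_biUnion_le
        (hhits j _ (fun x hx => ⟨(mem_DD.1 (mem_filter.1 hx).1).1, (mem_filter.1 hx).2⟩)))) _))
    rw [card_singleton, one_mul] at h1
    have h2 : ((DD U v j).card : ℝ) ≤ X.card + (∑ u ∈ R, ((DD U v j \ LL H U v j u).card : ℝ) +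
      r * (n : ℝ)^(r - 2)) := by exact_mod_cast h1
    have h3 : ∑ u ∈ R, ((DD U v j \ LL H U v j u).card : ℝ) ≤ ∑ u ∈ R, η * (n : ℝ)^(r - 1) := by
      apply sum_le_sum
      intro u hu
      have h4 := htyp j u (erase_subset _ _ (hRs hu))
      have h5 : LL H U v j u ⊆ DD U v j := filter_subset _ _
      rw [cast_card_sdiff h5]
      linarith
    rw [sum_const, hRc, nsmul_eq_mul] at h3
    push_cast at h3
    linarith
  have hn2 : (r : ℝ) * (n : ℝ)^(r - 2) ≤ κ / 2 * (n : ℝ)^(r - 1) := by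
    have h1 : (n : ℝ)^(r - 1) = n * (n : ℝ)^(r - 2) := by
      rw [← pow_succ']; congr 1; omega
    rw [h1, ← mul_assoc]
    apply mul_le_mul_of_nonneg_right _ (by positivity)
    nlinarith
  -- the cloned graph
  let F : (Fin r → V) → Finset V := fun x => (univ.erase j).image x
  have hXD : ∀ x ∈ X, ∀ l, l ≠ j → x l ∈ U l := fun x hx => (mem_DD.1 (mem_filter.1 hx).1).2
  have huniq : ∀ x ∈ X, ∀ l, l ≠ j → ∀ w ∈ F x, w ∈ U l → w = x l := by
    intro x hx l hl w hw hwl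
    obtain ⟨i, hi, rfl⟩ := mem_image.1 hw
    by_cases hil : i = l
    · rw [hil]
    · exact absurd hwl (Finset.disjoint_left.1 (hdisj i l hil) (hXD x hx i (ne_of_mem_erase hi)))
  have hFmem : ∀ x l, l ≠ j → x l ∈ F x := fun x l hl =>
    mem_image_of_mem x (mem_erase.2 ⟨hl, mem_univ _⟩)
  have hFinj : Set.InjOn F (X : Set (Fin r → V)) := by
    intro x hx y hy hxy
    funext l
    by_cases hl : l = j
    · rw [hl, (mem_DD.1 (mem_filter.1 hx).1).1, (mem_DD.1 (mem_filter.1 hy).1).1]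
    · exact huniq y hy l hl (x l) (hxy ▸ hFmem x l hl) (hXD x hx l hl)
  have hFc : ∀ x ∈ X, (F x).card = r - 1 := by
    intro x hx
    rw [card_image_of_injOn, card_erase_of_mem (mem_univ _), card_univ, Fintype.card_fin]
    intro k hk l hl hkl
    have hk' : k ≠ j := by simpa using hk
    have hl' : l ≠ j := by simpa using hl
    by_contra hne
    have hkl' : x k = x l := hkl
    exact Finset.disjoint_left.1 (hdisj k l hne) (hXD x hx k hk') (hkl' ▸ hXD x hx l hl')
  have hFv : ∀ x ∈ X, v ∉ F x := by
    intro x hx hv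
    obtain ⟨i, hi, hiv⟩ := mem_image.1 hv
    exact (mem_filter.1 hx).2.2 i (ne_of_mem_erase hi) hiv
  have hfree := clone hr2 hH hr U (hS v).one v j R (by omega) (X.image F)
    (by
      intro m hm; obtain ⟨x, hx, rfl⟩ := mem_image.1 hm; exact hFv x hx)
    (by
      intro m hm u hu; obtain ⟨x, hx, rfl⟩ := mem_image.1 hm
      have := (mem_filter.1 hx).2.1 u hu
      rwa [image_update] at this)
    (by
      intro m hm w hw; obtain ⟨x, hx, rfl⟩ := mem_image.1 hm
      obtain ⟨i, hi, rfl⟩ := mem_image.1 hw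
      exact ⟨i, ne_of_mem_erase hi, hXD x hx i (ne_of_mem_erase hi)⟩)
    (by
      intro m hm k hk; obtain ⟨x, hx, rfl⟩ := mem_image.1 hm
      exact ⟨x k, hFmem x k hk, hXD x hx k hk⟩)
    (by
      intro m hm; obtain ⟨x, hx, rfl⟩ := mem_image.1 hm; exact hFc x hx)
  have hle := hmax _ (by
    intro e he
    rw [mem_union, mem_filter, mem_image] at he
    rcases he with h | ⟨m, hm, rfl⟩
    · exact hr e h.1
    · obtain ⟨x, hx, rfl⟩ := mem_image.1 hm
      rw [card_insert_of_notMem (hFv x hx), hFc x hx]; omega) hfree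
  rw [card_union_of_disjoint, card_image_of_injOn, card_image_of_injOn hFinj] at hle
  · have h1 := card_filter_add_card_filter_not (s := H) (fun e => v ∈ e)
    have h2 : X.card ≤ (H.filter (fun e => v ∈ e)).card := by omega
    have h3 : (X.card : ℝ) ≤ (H.filter (fun e => v ∈ e)).card := by exact_mod_cast h2
    refine le_trans ?_ h3
    have h4 : (4 * r + 1) * η * (n : ℝ)^(r - 1) ≤ κ / 2 * (n : ℝ)^(r - 1) := by
      apply mul_le_mul_of_nonneg_right _ hνpos.le
      nlinarith
    nlinarith
  · intro m hm m' hm' hmm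
    obtain ⟨x, hx, rfl⟩ := mem_image.1 hm
    obtain ⟨x', hx', rfl⟩ := mem_image.1 hm'
    have h1 := congrArg (fun s => s.erase v) hmm
    simpa [erase_insert (hFv x hx), erase_insert (hFv x' hx')] using h1
  · rw [Finset.disjoint_left]
    intro e he he'
    obtain ⟨m, _, rfl⟩ := mem_image.1 he'
    exact (mem_filter.1 he).2 (mem_insert_self _ _)

/-- The complete `r`-partite graph of a colouring. -/
def cmp {V : Type} [DecidableEq V] [Fintype V] {r : ℕ} (P : V → Fin r) : Finset (Finset V) :=
  univ.filter (fun e => e.card = r ∧ ∀ k : Fin r, (e.filter (fun u => P u = k)).card = 1)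

lemma cmp_card {V : Type} [DecidableEq V] [Fintype V] {r : ℕ} (P : V → Fin r) :
    (cmp P).card = ∏ k, (univ.filter (fun u => P u = k)).card := by
  rw [← Fintype.card_piFinset]
  symm
  have hmem : ∀ x, x ∈ Fintype.piFinset (fun k => univ.filter (fun u => P u = k)) ↔
      ∀ k, P (x k) = k := by intro x; simp [Fintype.mem_piFinset]
  have hfil : ∀ x : Fin r → V, (∀ k, P (x k) = k) → ∀ k,
      (univ.image x).filter (fun u => P u = k) = {x k} := by
    intro x hx k
    ext w
    simp only [mem_filter, mem_image, mem_univ, true_and, mem_singleton]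
    constructor
    · rintro ⟨⟨l, rfl⟩, h⟩
      rw [hx l] at h; rw [h]
    · rintro rfl; exact ⟨⟨k, rfl⟩, hx k⟩
  apply card_bij (fun x _ => univ.image x)
  · intro x hx
    rw [hmem] at hx
    rw [cmp, mem_filter]
    refine ⟨mem_univ _, ?_, fun k => by rw [hfil x hx]; simp⟩
    rw [card_image_of_injective, card_univ, Fintype.card_fin]
    intro k l hkl
    rw [← hx k, hkl, hx l]
  · intro x hx y hy hxy
    rw [hmem] at hx hy
    funext k
    have h1 := hfil x hx k
    rw [hxy, hfil y hy k] at h1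
    exact (singleton_injective h1).symm
  · intro e he
    rw [cmp, mem_filter] at he
    obtain ⟨x, hx, hxe⟩ := cover (fun k => univ.filter (fun u => P u = k)) e he.2.1
      (by intro u _; exact ⟨P u, by simp⟩)
      (by
        intro k u hu w hw huk hwk
        simp only [mem_filter, mem_univ, true_and] at huk hwk
        exact card_le_one.1 (he.2.2 k).le u (mem_filter.2 ⟨hu, huk⟩) w (mem_filter.2 ⟨hw, hwk⟩))
    exact ⟨x, hx, hxe⟩

lemma cmp_free {V : Type} [DecidableEq V] [Fintype V] {r : ℕ} (hr2 : 2 ≤ r) (P : V → Fin r) :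
    DeltaFree r (cmp P) :=
  deltaFree_of_partite hr2 P (fun _ he => (mem_filter.1 he).2.2)

lemma cmp_unif {V : Type} [DecidableEq V] [Fintype V] {r : ℕ} (P : V → Fin r) :
    ∀ e ∈ cmp P, e.card = r := fun _ he => (mem_filter.1 he).2.1

lemma exists_cmp (r n : ℕ) (hr : 0 < r) : ∃ P : Fin n → Fin r, (n / r)^r ≤ (cmp P).card := by
  refine ⟨fun u => ⟨u.1 % r, Nat.mod_lt _ hr⟩, ?_⟩
  rw [cmp_card]
  have h : ∀ k : Fin r, n / r ≤
      (univ.filter (fun u : Fin n => (⟨u.1 % r, Nat.mod_lt _ hr⟩ : Fin r) = k)).card := by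
    intro k
    have hlt : ∀ i : Fin (n / r), i.1 * r + k.1 < n := by
      intro i
      have h1 : (i.1 + 1) * r ≤ n / r * r := Nat.mul_le_mul_right _ i.2
      have h2 := Nat.div_mul_le_self n r
      have h3 := k.2
      rw [add_mul, one_mul] at h1
      omega
    have := card_le_card_of_injOn (s := (univ : Finset (Fin (n / r))))
      (t := univ.filter (fun u : Fin n => (⟨u.1 % r, Nat.mod_lt _ hr⟩ : Fin r) = k))
      (fun i => ⟨i.1 * r + k.1, hlt i⟩) (by
        intro i _
        simp only [coe_filter, Set.mem_ofPred_eq, mem_univ, true_and]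
        apply Fin.ext
        simp [Nat.mul_add_mod_self_right, Nat.mod_eq_of_lt k.2]) (by
        intro i _ i' _ h
        have h1 : i.1 * r + k.1 = i'.1 * r + k.1 := congrArg Fin.val h
        apply Fin.ext
        exact Nat.eq_of_mul_eq_mul_right hr (by omega))
    simpa using this
  calc (n / r)^r = ∏ k : Fin r, (n / r) := by simp
    _ ≤ _ := prod_le_prod' fun k _ => h k

lemma balanced {n r : ℕ} (hr2 : 2 ≤ r) (P : Fin n → Fin r) (hpos : 0 < (cmp P).card)
    (hmax : ∀ P' : Fin n → Fin r, (cmp P').card ≤ (cmp P).card) (k : Fin r) :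
    (univ.filter (fun u => P u = k)).card = n / r ∨
    (univ.filter (fun u => P u = k)).card = n / r + 1 := by
  obtain ⟨a, ha⟩ : ∃ a : Fin r → ℕ, ∀ k, a k = (univ.filter (fun u => P u = k)).card := ⟨_, fun _ => rfl⟩
  rw [cmp_card] at hpos
  simp only [← ha] at hpos ⊢
  have hapos : ∀ k, 0 < a k := by
    intro k
    apply Nat.pos_of_ne_zero
    intro h0
    rw [prod_eq_zero (mem_univ k) h0] at hpos
    omega
  have hdiff : ∀ k l, a k ≤ a l + 1 := by
    intro k l
    by_contra hcon
    push Not at hcon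
    have hkl : k ≠ l := by rintro rfl; omega
    obtain ⟨u, hu⟩ : (univ.filter (fun u => P u = k)).Nonempty := by
      rw [← card_pos, ← ha]; exact hapos k
    have hPu : P u = k := (mem_filter.1 hu).2
    have h1 := hmax (Function.update P u l)
    rw [cmp_card, cmp_card] at h1
    obtain ⟨b, hb⟩ : ∃ b : Fin r → ℕ, ∀ k, b k = (univ.filter (fun w => Function.update P u l w = k)).card :=
      ⟨_, fun _ => rfl⟩
    simp only [← ha, ← hb] at h1
    have hbk : b k = a k - 1 := by
      rw [hb, ha, ← card_erase_of_mem hu]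
      congr 1
      ext w
      by_cases hw : w = u
      · subst hw; simp [hkl.symm]
      · simp [hw]
    have hbl : b l = a l + 1 := by
      have hnot : u ∉ univ.filter (fun u => P u = l) := by simp [hPu, hkl]
      rw [hb, ha, ← card_insert_of_notMem hnot]
      congr 1
      ext w
      by_cases hw : w = u
      · subst hw; simp
      · simp [hw]
    have hbo : ∀ i, i ≠ k → i ≠ l → b i = a i := by
      intro i hik hil
      rw [hb, ha]
      congr 1
      ext w
      by_cases hw : w = u
      · subst hw; simp [hPu, hik.symm, hil.symm]
      · simp [hw]
    have hl : l ∈ univ.erase k := mem_erase.2 ⟨hkl.symm, mem_univ _⟩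
    rw [← mul_prod_erase univ b (mem_univ k), ← mul_prod_erase univ a (mem_univ k),
      ← mul_prod_erase _ b hl, ← mul_prod_erase _ a hl, ← mul_assoc, ← mul_assoc, hbk, hbl] at h1
    have h2 : ∏ x ∈ (univ.erase k).erase l, b x = ∏ x ∈ (univ.erase k).erase l, a x := by
      apply prod_congr rfl
      intro i hi
      rw [mem_erase, mem_erase] at hi
      exact hbo i hi.2.1 hi.1
    rw [h2] at h1
    have h3 : 0 < ∏ x ∈ (univ.erase k).erase l, a x := prod_pos fun i _ => hapos i
    have h4 := Nat.le_of_mul_le_mul_right h1 h3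
    obtain ⟨d, hd⟩ := Nat.exists_eq_add_of_lt hcon
    rw [hd] at h4
    have h5 : a l + 1 + d + 1 - 1 = a l + 1 + d := by omega
    rw [h5] at h4
    nlinarith
  have hsum : ∑ i, a i = n := by
    have := card_eq_sum_card_fiberwise (s := (univ : Finset (Fin n))) (t := (univ : Finset (Fin r))) (f := P)
      (fun _ _ => mem_coe.2 (mem_univ _))
    rw [card_univ, Fintype.card_fin] at this
    rw [this]
    exact sum_congr rfl fun i _ => ha i
  have hr0 : 0 < r := by omega
  have hdm := Nat.div_add_mod n r
  have hml := Nat.mod_lt n hr0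
  by_contra hcon
  push Not at hcon
  rcases lt_or_gt_of_ne hcon.1 with h | h
  · have h1 : ∑ i, a i < ∑ i : Fin r, n / r := by
      apply sum_lt_sum
      · intro i _
        have := hdiff i k
        omega
      · exact ⟨k, mem_univ _, h⟩
    rw [hsum, sum_const, card_univ, Fintype.card_fin, smul_eq_mul] at h1
    omega
  · have h1 : ∑ i : Fin r, (n / r + 1) ≤ ∑ i, a i := by
      apply sum_le_sum
      intro i _
      have := hdiff k i
      omega
    rw [hsum, sum_const, card_univ, Fintype.card_fin, smul_eq_mul, mul_add, mul_one] at h1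
    omega

end HMantel

/-- Hypergraph Mantel theorem (degree-stability form): there exist `ε > 0` and
`N₀` such that for all `n ≥ N₀`, every `Δ_r`-free `r`-graph on `n` vertices
with `δ(H) ≥ n^{r-1}/r^{r-1} − ε n^{r-1}` is `r`-partite; consequently every
`Δ_r`-free `r`-graph on `n` vertices with the maximum number of edges is (up to
isomorphism) the balanced complete `r`-partite `r`-graph `T^r(n)`. -/
theorem hypergraph_mantel :
    ∀ r : ℕ, 2 ≤ r → ∃ ε > (0 : ℝ), ∃ N₀ : ℕ, ∀ n : ℕ, N₀ ≤ n →
      (∀ H : Finset (Finset (Fin n)), (∀ e ∈ H, e.card = r) → DeltaFree r H →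
        (∀ v : Fin n, (n : ℝ) ^ (r - 1) / (r : ℝ) ^ (r - 1) - ε * (n : ℝ) ^ (r - 1) ≤
          ((H.filter (fun e => v ∈ e)).card : ℝ)) →
        RPartite r H) ∧
      (∀ H : Finset (Finset (Fin n)), (∀ e ∈ H, e.card = r) → DeltaFree r H →
        (∀ H' : Finset (Finset (Fin n)), (∀ e ∈ H', e.card = r) → DeltaFree r H' →
          H'.card ≤ H.card) →
        ∃ P : Fin n → Fin r,
          (∀ k : Fin r, (Finset.univ.filter (fun u : Fin n => P u = k)).card = n / r ∨
            (Finset.univ.filter (fun u : Fin n => P u = k)).card = n / r + 1) ∧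
          ∀ e : Finset (Fin n),
            e ∈ H ↔ (e.card = r ∧ ∀ k : Fin r, (e.filter (fun u => P u = k)).card = 1)) := by
  intro r hr2
  have hr0 : (0 : ℝ) < r := by exact_mod_cast (by omega : 0 < r)
  have hr1 : (1 : ℝ) ≤ r := by exact_mod_cast (by omega : 1 ≤ r)
  obtain ⟨κ, hκ⟩ : ∃ κ : ℝ, κ = 1 / (100 * (r : ℝ)^r) := ⟨_, rfl⟩
  have hκ0 : 0 < κ := by rw [hκ]; positivity
  obtain ⟨η, hη⟩ : ∃ η : ℝ, η = κ / (10 * r) := ⟨_, rfl⟩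
  have hη0 : 0 < η := by rw [hη]; positivity
  have hηκ : η ≤ κ := by
    rw [hη]; apply div_le_self hκ0.le; linarith
  obtain ⟨ε₁, hε₁, N₁, hstab⟩ := HMantel.stability r hr2 η hη0
  obtain ⟨N₂, hN₂⟩ := exists_nat_gt ((r : ℝ) * r / κ)
  obtain ⟨N₃, hN₃⟩ := exists_nat_gt ((r : ℝ) * r / ε₁)
  have hκQ : ∀ x : ℝ, x / (r : ℝ)^(r - 1) = 100 * r * κ * x := by
    intro x
    have h1 : (r : ℝ)^r = r * (r : ℝ)^(r - 1) := by rw [← pow_succ']; congr 1; omega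
    rw [hκ, h1]; field_simp
  have hκR : 1 / (r : ℝ)^r = 100 * κ := by rw [hκ]; field_simp
  refine ⟨min κ ε₁, lt_min hκ0 hε₁, max (max N₁ N₂) N₃, fun n hn => ?_⟩
  have hn1 : N₁ ≤ n := (le_max_left _ _).trans ((le_max_left _ _).trans hn)
  have hn2 : (r : ℝ) * r ≤ κ * n := by
    have h1 : (N₂ : ℝ) ≤ n := by exact_mod_cast (le_max_right _ _).trans ((le_max_left _ _).trans hn)
    rw [div_lt_iff₀ hκ0] at hN₂
    nlinarith
  have hn3 : (r : ℝ) * r ≤ ε₁ * n := by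
    have h1 : (N₃ : ℝ) ≤ n := by exact_mod_cast (le_max_right _ _).trans hn
    rw [div_lt_iff₀ hε₁] at hN₃
    nlinarith
  have hn0 : (0 : ℝ) < n := by
    by_contra hc
    have : (0 : ℝ) < r * r := by positivity
    nlinarith
  have hnr : (n : ℝ)^r = n * (n : ℝ)^(r - 1) := by
    rw [← pow_succ']; congr 1; omega
  constructor
  · intro H hr hH hdeg
    have hν : (0 : ℝ) ≤ (n : ℝ)^(r - 1) := by positivity
    have hdeg' : ∀ v : Fin n, (100 * r * κ - min κ ε₁) * (n : ℝ)^(r - 1) ≤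
        ((H.filter (fun e => v ∈ e)).card : ℝ) := by
      intro v
      have := hdeg v
      rw [hκQ] at this
      linarith
    have hds : ∑ v : Fin n, (H.filter (fun e => v ∈ e)).card = r * H.card := by
      have h1 : ∑ v : Fin n, (H.filter (fun e => v ∈ e)).card = ∑ e ∈ H, e.card := by
        simp only [Finset.card_filter]
        rw [Finset.sum_comm]
        apply Finset.sum_congr rfl
        intro e _
        simp
      rw [h1, Finset.sum_congr rfl hr, Finset.sum_const, smul_eq_mul, mul_comm]
    have hcard : (1 / (r : ℝ)^r - ε₁) * (n : ℝ)^r ≤ H.card := by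
      have h1 : ∑ v : Fin n, (100 * r * κ - min κ ε₁) * (n : ℝ)^(r - 1) ≤
          ∑ v : Fin n, ((H.filter (fun e => v ∈ e)).card : ℝ) :=
        Finset.sum_le_sum fun v _ => hdeg' v
      have h2 : ∑ v : Fin n, ((H.filter (fun e => v ∈ e)).card : ℝ) = r * H.card := by
        exact_mod_cast hds
      rw [h2, Finset.sum_const, Finset.card_univ, Fintype.card_fin, nsmul_eq_mul] at h1
      have h3 : (100 * r * κ - r * ε₁) * (n : ℝ)^r ≤ (100 * r * κ - min κ ε₁) * (n : ℝ)^r := by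
        apply mul_le_mul_of_nonneg_right _ (by positivity)
        have := min_le_right κ ε₁
        nlinarith
      rw [hκR]
      have h4 : (r : ℝ) * ((100 * κ - ε₁) * (n : ℝ)^r) ≤ r * H.card := by
        rw [hnr] at h3 ⊢
        linarith
      exact le_of_mul_le_mul_left h4 hr0
    obtain ⟨U, hU⟩ := hstab (Fin n) (by simpa using hn1) H hr hH (by simpa using hcard)
    refine HMantel.part1 hr2 hH hr hU hκ hηκ (by simpa using hn2) ?_
    intro v
    rw [Fintype.card_fin]
    refine le_trans (mul_le_mul_of_nonneg_right ?_ hν) (hdeg' v)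
    have := min_le_left κ ε₁
    linarith
  · intro H hr hH hmax
    obtain ⟨P₀, hP₀⟩ := HMantel.exists_cmp r n (by omega)
    have h0 := hP₀.trans (hmax _ (HMantel.cmp_unif P₀) (HMantel.cmp_free hr2 P₀))
    have hrn : (r : ℝ) * r ≤ n := by
      have : κ ≤ 1 := by
        rw [hκ, div_le_one (by positivity)]
        have := one_le_pow₀ hr1 (n := r)
        linarith
      nlinarith
    have hcard : (1 / (r : ℝ)^r - ε₁) * (n : ℝ)^r ≤ H.card := by
      have h1 : ((n / r : ℕ) : ℝ)^r ≤ H.card := by exact_mod_cast h0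
      refine le_trans ?_ h1
      have h2 : (n : ℝ) / r * (1 + -(r / n)) ≤ ((n / r : ℕ) : ℝ) := by
        have h3 := Nat.lt_div_mul_add (a := n) (b := r) (by omega)
        have h4 : (n : ℝ) < (n / r : ℕ) * r + r := by exact_mod_cast h3
        have h5 : (n : ℝ) / r * (1 + -(r / n)) = n / r - 1 := by field_simp; ring
        rw [h5, sub_le_iff_le_add, div_le_iff₀ hr0]
        linarith
      have hle1 : (r : ℝ) / n ≤ 1 := by
        rw [div_le_one hn0]; nlinarith
      have h6 : (0 : ℝ) ≤ (n : ℝ) / r * (1 + -(r / n)) :=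
        mul_nonneg (by positivity) (by linarith)
      refine le_trans ?_ (pow_le_pow_left₀ h6 h2 r)
      rw [mul_pow]
      have h7 := one_add_mul_le_pow (a := -((r : ℝ) / n)) (by linarith) r
      refine le_trans ?_ (mul_le_mul_of_nonneg_left h7 (by positivity))
      rw [div_pow]
      have h8 : (n : ℝ)^r / (r : ℝ)^r * (1 + r * -(r / n)) =
          (1 / (r : ℝ)^r - 1 / (r : ℝ)^r * (r * r / n)) * (n : ℝ)^r := by
        field_simp
        ring
      rw [h8]
      apply mul_le_mul_of_nonneg_right _ (by positivity)
      have h9 : (r : ℝ) * r / n ≤ ε₁ := by rw [div_le_iff₀ hn0]; exact hn3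
      have h10 : 1 / (r : ℝ)^r ≤ 1 := by
        rw [div_le_one (by positivity)]; exact one_le_pow₀ hr1
      have h11 : 1 / (r : ℝ)^r * (r * r / n) ≤ 1 * (r * r / n) :=
        mul_le_mul_of_nonneg_right h10 (by positivity)
      linarith
    obtain ⟨U, hU⟩ := hstab (Fin n) (by simpa using hn1) H hr hH (by simpa using hcard)
    obtain ⟨P, hP⟩ := HMantel.part1 hr2 hH hr hU hκ hηκ (by simpa using hn2)
      (HMantel.extremal_deg hr2 hH hr hU hκ hη (by simpa using hn2) hmax)
    have hsub : H ⊆ HMantel.cmp P := by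
      intro e he
      rw [HMantel.cmp, Finset.mem_filter]
      exact ⟨Finset.mem_univ _, hr e he, hP e he⟩
    have hEq : H = HMantel.cmp P :=
      Finset.eq_of_subset_of_card_le hsub (hmax _ (HMantel.cmp_unif P) (HMantel.cmp_free hr2 P))
    have hpos : 0 < H.card := by
      refine lt_of_lt_of_le ?_ h0
      apply Nat.pow_pos
      apply Nat.div_pos _ (by omega)
      have : (r : ℝ) ≤ n := by nlinarith
      exact_mod_cast this
    refine ⟨P, ?_, ?_⟩
    · apply HMantel.balanced hr2 P (hEq ▸ hpos)
      intro P'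
      rw [← hEq]
      exact hmax _ (HMantel.cmp_unif P') (HMantel.cmp_free hr2 P')
    · intro e
      rw [hEq, HMantel.cmp, Finset.mem_filter]
      simp
end

section
/- Every T_r-free r-graph H on n ≥ r vertices satisfies |H| ≤ n^r/r^r, with equality if and only if r divides n and H is isomorphic to the balanced complete r-partite r-graph T^r(n). -/
/-- An `r`-graph is `𝒯_r`-free if it contains no three (distinct) edges `A, B, C`
with `A ⊆ B ∪ C` and `(B ∩ C) \ A ≠ ∅`. -/
def TriangleFree {V : Type*} [DecidableEq V] (H : Finset (Finset V)) : Prop :=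
  ¬ ∃ A ∈ H, ∃ B ∈ H, ∃ C ∈ H, A ≠ B ∧ A ≠ C ∧ B ≠ C ∧
      A ⊆ B ∪ C ∧ ((B ∩ C) \ A).Nonempty

open Finset

/-- Vertices extending `S` inside an edge of `H`. -/
def nbh {n : ℕ} (H : Finset (Finset (Fin n))) (S : Finset (Fin n)) : Finset (Fin n) :=
  univ.filter (fun w => w ∉ S ∧ ∃ B ∈ H, insert w S ⊆ B)

lemma mem_nbh {n : ℕ} {H : Finset (Finset (Fin n))} {S : Finset (Fin n)} {w : Fin n} :
    w ∈ nbh H S ↔ w ∉ S ∧ ∃ B ∈ H, insert w S ⊆ B := by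
  simp [nbh]

lemma nbh_disj {n r : ℕ} {H : Finset (Finset (Fin n))} (hu : ∀ e ∈ H, e.card = r)
    (hfree : TriangleFree H) {A S T : Finset (Fin n)} (hA : A ∈ H) (hST : S ∪ T = A) :
    Disjoint (nbh H S) (nbh H T) := by
  rw [Finset.disjoint_left]
  intro w hS hT
  rw [mem_nbh] at hS hT
  obtain ⟨hwS, B, hB, hSB⟩ := hS
  obtain ⟨hwT, C, hC, hTC⟩ := hT
  have hwA : w ∉ A := by rw [← hST]; simp [hwS, hwT]
  have hwB : w ∈ B := hSB (mem_insert_self _ _)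
  have hwC : w ∈ C := hTC (mem_insert_self _ _)
  have hsub : A ⊆ B ∪ C := by
    rw [← hST]
    exact union_subset_union ((subset_insert _ _).trans hSB) ((subset_insert _ _).trans hTC)
  apply hfree
  refine ⟨A, hA, B, hB, C, hC, ?_, ?_, ?_, hsub, ⟨w, by simp [hwA, hwB, hwC]⟩⟩
  · rintro rfl; exact hwA hwB
  · rintro rfl; exact hwA hwC
  · rintro rfl
    rw [union_self] at hsub
    have := Finset.eq_of_subset_of_card_le hsub (by rw [hu _ hA, hu _ hB])
    exact hwA (this ▸ hwB)

lemma nbh_anti {n : ℕ} {H : Finset (Finset (Fin n))} {S T : Finset (Fin n)} {w : Fin n}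
    (hST : S ⊆ T) (hw : w ∈ nbh H T) : w ∈ nbh H S := by
  rw [mem_nbh] at *
  obtain ⟨h1, B, hB, h2⟩ := hw
  exact ⟨fun h => h1 (hST h), B, hB, (insert_subset_insert _ hST).trans h2⟩

/-- Andersen inequality for superadditive sequences. -/
lemma andersen (r : ℕ) (a : ℕ → ℝ)
    (h : ∀ i j, 1 ≤ i → 1 ≤ j → i + j ≤ r → a i + a j ≤ a (i + j)) :
    ∀ m, 1 ≤ m → m ≤ r → ∑ i ∈ range m, a (i + 1) / (i + 1 : ℝ) ≤ a m := by
  intro m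
  induction m using Nat.strong_induction_on with
  | _ m ih =>
    intro h1 h2
    obtain ⟨k, rfl⟩ : ∃ k, m = k + 1 := ⟨m - 1, by omega⟩
    -- sum of partial sums
    have key : ∀ k : ℕ, ∑ j ∈ range k, ∑ i ∈ range (j + 1), a (i + 1) / (i + 1 : ℝ)
        = (k + 1) * ∑ i ∈ range k, a (i + 1) / (i + 1 : ℝ) - ∑ i ∈ range k, a (i + 1) := by
      intro k
      induction k with
      | zero => simp
      | succ k ihk =>
        rw [sum_range_succ, ihk, sum_range_succ (fun i => a (i + 1)),
          sum_range_succ (fun i : ℕ => a (i + 1) / (i + 1 : ℝ))]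
        push_cast
        have : (k + 1 : ℝ) ≠ 0 := by positivity
        field_simp
        ring
    have h3 : ∑ j ∈ range k, ∑ i ∈ range (j + 1), a (i + 1) / (i + 1 : ℝ)
        ≤ ∑ j ∈ range k, a (j + 1) := by
      apply sum_le_sum
      intro j hj
      rw [mem_range] at hj
      exact ih (j + 1) (by omega) (by omega) (by omega)
    have h4 : 2 * ∑ j ∈ range k, a (j + 1) ≤ k * a (k + 1) := by
      have h5 := Finset.sum_range_reflect (fun j => a (j + 1)) k
      calc 2 * ∑ j ∈ range k, a (j + 1)
          = ∑ j ∈ range k, (a (k - 1 - j + 1) + a (j + 1)) := by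
            rw [sum_add_distrib, h5]; ring
        _ ≤ ∑ j ∈ range k, a (k + 1) := by
            apply sum_le_sum
            intro j hj
            rw [mem_range] at hj
            have := h (k - 1 - j + 1) (j + 1) (by omega) (by omega) (by omega)
            rwa [show k - 1 - j + 1 + (j + 1) = k + 1 by omega] at this
        _ = k * a (k + 1) := by simp
    rw [key] at h3
    rw [sum_range_succ]
    have hk : (0 : ℝ) < k + 1 := by positivity
    have h6 : (k + 1 : ℝ) * ∑ i ∈ range k, a (i + 1) / (i + 1 : ℝ) ≤ k * a (k + 1) := by linarith
    have h7 : ∑ i ∈ range k, a (i + 1) / (i + 1 : ℝ) ≤ k * a (k + 1) / (k + 1) := by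
      rw [le_div_iff₀ hk]; linarith
    calc _ ≤ k * a (k + 1) / (k + 1) + a (k + 1) / (k + 1) := by linarith
      _ = a (k + 1) := by field_simp

lemma prod_inv_ge {ι : Type*} (s : Finset ι) (z : ι → ℝ) (hz : ∀ i ∈ s, 0 < z i) :
    1 + ∑ i ∈ s, (1 - z i) ≤ ∏ i ∈ s, (z i)⁻¹ ∧
    (1 + ∑ i ∈ s, (1 - z i) = ∏ i ∈ s, (z i)⁻¹ → ∀ i ∈ s, z i = 1) := by
  have hp : 0 < ∏ i ∈ s, (z i)⁻¹ := prod_pos fun i hi => inv_pos.2 (hz i hi)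
  have h1 := Real.log_le_sub_one_of_pos hp
  rw [Real.log_prod (fun i hi => (inv_pos.2 (hz i hi)).ne')] at h1
  have h2 : ∀ i ∈ s, 1 - z i ≤ Real.log (z i)⁻¹ := by
    intro i hi
    rw [Real.log_inv]
    linarith [Real.log_le_sub_one_of_pos (hz i hi)]
  have h3 := sum_le_sum h2
  refine ⟨by linarith, fun heq i hi => ?_⟩
  by_contra hne
  have h4 : ∑ i ∈ s, (1 - z i) < ∑ i ∈ s, Real.log (z i)⁻¹ := by
    apply sum_lt_sum h2
    refine ⟨i, hi, ?_⟩
    rw [Real.log_inv]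
    linarith [Real.log_lt_sub_one_of_pos (hz i hi) hne]
  linarith

/-- The first `k` indices. -/
def pre (r k : ℕ) : Finset (Fin r) := univ.filter (fun i => i.val < k)

lemma card_pre (r k : ℕ) (h : k ≤ r) : (pre r k).card = k := by
  unfold pre
  rw [Fin.card_filter_val_lt]; omega

lemma process_le {V : Type*} [Fintype V] [DecidableEq V] (q : Finset V → V → ℝ)
    (hq : ∀ S v, 0 ≤ q S v) (hs : ∀ S, ∑ v, q S v ≤ 1) (k : ℕ) :
    ∑ v : Fin k → V, ∏ j : Fin k, q ((pre k j).image v) (v j) ≤ 1 := by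
  induction k with
  | zero => simp
  | succ k ih =>
    rw [← (Fin.snocEquiv (fun _ : Fin (k+1) => V)).sum_comp, Fintype.sum_prod_type_right]
    refine le_trans (sum_le_sum (g := fun v : Fin k → V =>
      ∏ j : Fin k, q ((pre k j).image v) (v j)) ?_) ih
    intro v _
    have e : ∀ x : V, ∏ j : Fin (k+1), q ((pre (k+1) j).image
        ((Fin.snocEquiv (fun _ : Fin (k+1) => V)) (x, v)))
        ((Fin.snocEquiv (fun _ : Fin (k+1) => V)) (x, v) j)
        = (∏ j : Fin k, q ((pre k j).image v) (v j)) * q (univ.image v) x := by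
      intro x
      have im : ∀ m, m ≤ k → (pre (k+1) m).image
        ((Fin.snocEquiv (fun _ : Fin (k+1) => V)) (x, v)) = (pre k m).image v := by
        intro m hm
        ext y
        simp only [mem_image, pre, mem_filter, mem_univ, true_and]
        constructor
        · rintro ⟨i, hi, rfl⟩
          refine ⟨⟨i.val, by omega⟩, hi, ?_⟩
          have h0 : (i : ℕ) < k := by omega
          simp [Fin.snocEquiv, Fin.snoc, h0, Fin.castLT]
        · rintro ⟨i, hi, rfl⟩
          exact ⟨i.castSucc, hi, by simp [Fin.snocEquiv]⟩
      rw [Fin.prod_univ_castSucc]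
      congr 1
      · apply prod_congr rfl
        intro j _
        rw [im _ (by simp)]
        simp [Fin.snocEquiv]
      · rw [im _ (by simp)]
        have : pre k (Fin.last k) = univ := by
          ext i; simp [pre]
        rw [this]; simp [Fin.snocEquiv]
    simp_rw [e]
    rw [← mul_sum]
    exact mul_le_of_le_one_right (prod_nonneg fun _ _ => hq _ _) (hs _)

lemma exists_perm {r : ℕ} (X Y : Finset (Fin r)) (h : X.card = Y.card) :
    ∃ τ : Equiv.Perm (Fin r), X.image τ = Y := by
  obtain e : X ≃ Y := Finset.equivOfCardEq h
  refine ⟨e.extendSubtype, ?_⟩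
  apply Finset.eq_of_subset_of_card_le
  · intro y hy
    rw [mem_image] at hy
    obtain ⟨x, hx, rfl⟩ := hy
    exact e.extendSubtype_mem x hx
  · rw [card_image_of_injective _ (Equiv.injective _), h]

/-- Ordered edges. -/
def tup {n : ℕ} (r : ℕ) (H : Finset (Finset (Fin n))) : Finset (Fin r → Fin n) :=
  univ.filter (fun v => univ.image v ∈ H)

lemma mem_tup {n r : ℕ} {H : Finset (Finset (Fin n))} {v : Fin r → Fin n} :
    v ∈ tup r H ↔ univ.image v ∈ H := by simp [tup]

lemma tup_inj {n r : ℕ} {H : Finset (Finset (Fin n))} (hu : ∀ e ∈ H, e.card = r)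
    {v : Fin r → Fin n} (hv : v ∈ tup r H) : Function.Injective v := by
  rw [mem_tup] at hv
  have h := hu _ hv
  have h2 : (univ.image v).card = (univ : Finset (Fin r)).card := by simp [h]
  have := Finset.card_image_iff.1 h2
  simpa [Set.injOn_univ] using this

lemma tup_perm {n r : ℕ} {H : Finset (Finset (Fin n))} (τ : Equiv.Perm (Fin r))
    {v : Fin r → Fin n} : v ∘ τ ∈ tup r H ↔ v ∈ tup r H := by
  rw [mem_tup, mem_tup]
  have : univ.image (v ∘ τ) = univ.image v := by
    rw [← Finset.image_image, Finset.image_univ_equiv]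
  rw [this]

lemma card_tup {n r : ℕ} {H : Finset (Finset (Fin n))} (hu : ∀ e ∈ H, e.card = r) :
    (tup r H).card = H.card * r.factorial := by
  rw [Finset.card_eq_sum_card_fiberwise (f := fun v => univ.image v) (t := H)
    (fun v hv => mem_tup.1 hv)]
  apply Finset.sum_const_nat
  intro A hA
  have hAc := hu A hA
  obtain e : Fin r ≃ A := (Finset.equivFinOfCardEq hAc).symm
  have : (univ : Finset (Equiv.Perm (Fin r))).card = r.factorial := by
    rw [Finset.card_univ, Fintype.card_perm, Fintype.card_fin]
  rw [← this]
  symm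
  have hA' : univ.image (fun i => (e i : Fin n)) = A := by
    ext x; simp only [mem_image, mem_univ, true_and]
    constructor
    · rintro ⟨i, rfl⟩; exact (e i).2
    · intro hx; exact ⟨e.symm ⟨x, hx⟩, by simp⟩
  apply Finset.card_bij (fun (σ : Equiv.Perm (Fin r)) _ => (fun i => (e i : Fin n)) ∘ σ)
  · intro σ _
    rw [mem_filter, tup_perm, mem_tup, hA', ← Finset.image_image, Finset.image_univ_equiv]
    exact ⟨hA, hA'⟩
  · intro σ _ σ' _ h
    ext i
    have := congrFun h i
    simp only [Function.comp] at this
    rw [e.injective (Subtype.ext this)]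
  · intro v hv
    rw [mem_filter] at hv
    have hi := tup_inj hu hv.1
    have hm : ∀ i, v i ∈ A := fun i => by rw [← hv.2]; exact mem_image_of_mem _ (mem_univ _)
    have hb : Function.Bijective (fun i => e.symm ⟨v i, hm i⟩) := by
      apply Finite.injective_iff_bijective.1
      intro i j hij
      have := e.symm.injective hij
      exact hi (by simpa using this)
    refine ⟨Equiv.ofBijective _ hb, mem_univ _, ?_⟩
    ext i; simp

lemma sum_perm_inv {n r : ℕ} {H : Finset (Finset (Fin n))} (X Y : Finset (Fin r))
    (h : X.card = Y.card) (f : Finset (Fin n) → ℝ) :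
    ∑ v ∈ tup r H, f (X.image v) = ∑ v ∈ tup r H, f (Y.image v) := by
  obtain ⟨τ, rfl⟩ := exists_perm X Y h
  symm
  apply Finset.sum_equiv (τ.arrowCongr (Equiv.refl _)).symm
  · intro v
    exact (tup_perm τ).symm
  · intro v _
    congr 1
    rw [Finset.image_image]
    rfl

lemma superadd {n r : ℕ} {H : Finset (Finset (Fin n))} (hu : ∀ e ∈ H, e.card = r)
    (hfree : TriangleFree H) (i j : ℕ) (hij : i + j ≤ r) :
    ∑ v ∈ tup r H, ((nbh H ((pre r (r - i)).image v)).card : ℝ)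
    + ∑ v ∈ tup r H, ((nbh H ((pre r (r - j)).image v)).card : ℝ)
    ≤ ∑ v ∈ tup r H, ((nbh H ((pre r (r - (i + j))).image v)).card : ℝ) := by
  set Y : Finset (Fin r) := pre r (r - (i+j)) ∪ (pre r (r - i))ᶜ with hY
  have hYc : (pre r (r - j)).card = Y.card := by
    rw [hY, card_union_of_disjoint, card_compl, card_pre, card_pre, card_pre, Fintype.card_fin]
      <;> try omega
    rw [disjoint_left]
    intro a
    simp [pre]; omega
  rw [sum_perm_inv (pre r (r - j)) Y hYc (fun S => ((nbh H S).card : ℝ)), ← sum_add_distrib]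
  apply sum_le_sum
  intro v hv
  have hd : Disjoint (nbh H ((pre r (r - i)).image v)) (nbh H (Y.image v)) := by
    apply nbh_disj hu hfree (mem_tup.1 hv)
    rw [← image_union]
    congr 1
    ext a; simp [hY, pre]; omega
  rw [← Nat.cast_add, ← card_union_of_disjoint hd]
  norm_cast
  apply card_le_card
  intro w hw
  rw [mem_union] at hw
  rcases hw with hw | hw
  · exact nbh_anti (image_subset_image (by intro a; simp [pre]; omega)) hw
  · exact nbh_anti (image_subset_image (by rw [hY]; exact subset_union_left)) hw

lemma mem_nbh_tup {n r : ℕ} {H : Finset (Finset (Fin n))} (hu : ∀ e ∈ H, e.card = r)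
    {v : Fin r → Fin n} (hv : v ∈ tup r H) {X : Finset (Fin r)} {i : Fin r} (hi : i ∉ X) :
    v i ∈ nbh H (X.image v) := by
  rw [mem_nbh]
  refine ⟨?_, _, mem_tup.1 hv, ?_⟩
  · rw [mem_image]
    rintro ⟨j, hj, h⟩
    exact hi (tup_inj hu hv h ▸ hj)
  · rw [← image_insert]
    exact image_subset_image (subset_univ _)

lemma process_tup {n r : ℕ} {H : Finset (Finset (Fin n))} (hu : ∀ e ∈ H, e.card = r) :
    ∑ v ∈ tup r H, ∏ j : Fin r, ((nbh H ((pre r j).image v)).card : ℝ)⁻¹ ≤ 1 := by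
  classical
  refine le_trans ?_ (process_le (fun S w => if w ∈ nbh H S then ((nbh H S).card : ℝ)⁻¹ else 0)
    ?_ ?_ r)
  · refine le_trans (le_of_eq ?_) (sum_le_sum_of_subset_of_nonneg (subset_univ (tup r H)) ?_)
    · apply sum_congr rfl
      intro v hv
      apply prod_congr rfl
      intro j _
      rw [if_pos]
      exact mem_nbh_tup hu hv (by simp [pre])
    · intro v _ _
      exact prod_nonneg fun j _ => by split_ifs <;> positivity
  · intro S v; split_ifs <;> positivity
  · intro S
    rw [← sum_filter]
    simp only [filter_mem_eq_inter, univ_inter, sum_const, nsmul_eq_mul]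
    exact mul_inv_le_one

lemma div_aux (s d n r : ℝ) (hd : d ≠ 0) (hn : n ≠ 0) (hr : r ≠ 0) :
    s / (d * (n / r)) = r / n * (s / d) := by
  field_simp

set_option maxHeartbeats 1000000 in
lemma main_ineq {n r : ℕ} (hr : 2 ≤ r) (hn : r ≤ n) {H : Finset (Finset (Fin n))}
    (hu : ∀ e ∈ H, e.card = r) (hfree : TriangleFree H) :
    (H.card : ℝ) ≤ (n : ℝ) ^ r / (r : ℝ) ^ r ∧
    ((H.card : ℝ) = (n : ℝ) ^ r / (r : ℝ) ^ r → ∀ v ∈ tup r H, ∀ k : Fin r,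
      ((nbh H ((pre r k).image v)).card : ℝ) = (r - k : ℝ) * (n / r)) := by
  have hr0 : (0 : ℝ) < r := by positivity
  have hn0 : (0 : ℝ) < n := by
    have : 0 < n := by omega
    positivity
  set y : (Fin r → Fin n) → Fin r → ℝ := fun v k => ((nbh H ((pre r k).image v)).card : ℝ) with hy
  set c : Fin r → ℝ := fun k => (r - k : ℝ) * (n / r) with hc
  have hcpos : ∀ k, 0 < c k := by
    intro k
    have : (k : ℝ) < r := by exact_mod_cast k.2
    have : (0 : ℝ) < r - k := by linarith
    simp only [hc]; positivity
  have hypos : ∀ v ∈ tup r H, ∀ k, 0 < y v k := by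
    intro v hv k
    simp only [hy]
    have := card_pos.2 ⟨_, mem_nbh_tup hu hv (X := pre r k) (i := k) (by simp [pre])⟩
    exact_mod_cast this
  have hcprod : ∏ k, c k = r.factorial * (n / r : ℝ) ^ r := by
    simp only [hc]
    rw [prod_mul_distrib, prod_const, card_univ, Fintype.card_fin]
    congr 1
    rw [Fin.prod_univ_eq_prod_range (fun i : ℕ => (r - i : ℝ)) r, ← prod_range_reflect,
      ← Finset.prod_range_add_one_eq_factorial]
    push_cast
    apply prod_congr rfl
    intro i hi
    rw [mem_range] at hi
    rw [Nat.sub_sub, Nat.cast_sub (by omega)]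
    push_cast; ring
  have hpt : ∀ v ∈ tup r H, 1 + ∑ k, (1 - y v k / c k) ≤ (∏ k, c k) * ∏ k, (y v k)⁻¹ ∧
      (1 + ∑ k, (1 - y v k / c k) = (∏ k, c k) * ∏ k, (y v k)⁻¹ → ∀ k, y v k = c k) := by
    intro v hv
    have h := prod_inv_ge univ (fun k => y v k / c k) (fun k _ => div_pos (hypos v hv k) (hcpos k))
    have e : ∏ k, (y v k / c k)⁻¹ = (∏ k, c k) * ∏ k, (y v k)⁻¹ := by
      rw [← prod_mul_distrib]
      apply prod_congr rfl
      intro k _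
      rw [inv_div]; rfl
    rw [e] at h
    refine ⟨h.1, fun he k => ?_⟩
    have := h.2 he k (mem_univ _)
    exact (div_eq_one_iff_eq (hcpos k).ne').1 this
  -- the linear bound
  have hlin : ∑ v ∈ tup r H, ∑ k, y v k / c k ≤ r * (tup r H).card := by
    set a : ℕ → ℝ := fun i => ∑ v ∈ tup r H, ((nbh H ((pre r (r - i)).image v)).card : ℝ) with ha
    have hA := andersen r a (fun i j _ _ h => superadd hu hfree i j h) r (by omega) le_rfl
    have har : a r ≤ n * (tup r H).card := by
      simp only [ha]
      refine le_trans (sum_le_card_nsmul _ _ (n : ℝ) ?_) ?_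
      · intro v _
        have := card_le_univ (nbh H ((pre r (r - r)).image v))
        rw [Fintype.card_fin] at this
        exact_mod_cast this
      · rw [nsmul_eq_mul, mul_comm]
    rw [sum_comm]
    have e : ∑ k : Fin r, ∑ v ∈ tup r H, y v k / c k
        = (r / n : ℝ) * ∑ i ∈ range r, a (i + 1) / (i + 1 : ℝ) := by
      rw [← sum_range_reflect, mul_sum,
        ← Fin.sum_univ_eq_sum_range (fun j : ℕ => (r / n : ℝ) * (a (r - 1 - j + 1) /
          ((r - 1 - j : ℕ) + 1 : ℝ))) r]
      apply sum_congr rfl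
      intro k _
      have hk := k.2
      rw [← sum_div]
      have e1 : r - (r - 1 - (k : ℕ) + 1) = k := by omega
      have e2 : ((r - 1 - k : ℕ) + 1 : ℝ) = r - k := by
        rw [Nat.sub_sub, Nat.cast_sub (by omega)]; push_cast; ring
      rw [e2]
      simp only [ha, e1, hy, hc]
      have : (k : ℝ) < r := by exact_mod_cast k.2
      have hrk : (r - k : ℝ) ≠ 0 := by linarith
      exact div_aux _ _ _ _ hrk hn0.ne' hr0.ne'
    rw [e]
    calc (r / n : ℝ) * ∑ i ∈ range r, a (i + 1) / (i + 1 : ℝ)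
        ≤ (r / n : ℝ) * (n * (tup r H).card) := by
          apply mul_le_mul_of_nonneg_left (hA.trans har); positivity
      _ = r * (tup r H).card := by field_simp
  have hsumge : ((tup r H).card : ℝ) ≤ ∑ v ∈ tup r H, (1 + ∑ k, (1 - y v k / c k)) := by
    simp only [sum_add_distrib, sum_sub_distrib, sum_const, card_univ, Fintype.card_fin,
      nsmul_eq_mul]
    linarith
  have hproc := process_tup (r := r) hu
  have hfin : ∑ v ∈ tup r H, (∏ k, c k) * ∏ k, (y v k)⁻¹ ≤ ∏ k, c k := by
    rw [← mul_sum]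
    exact mul_le_of_le_one_right (prod_nonneg fun k _ => (hcpos k).le) hproc
  have hmid := sum_le_sum (fun v hv => (hpt v hv).1)
  have hM : ((tup r H).card : ℝ) = H.card * r.factorial := by
    rw [card_tup hu]; push_cast; ring
  have hf : (0 : ℝ) < r.factorial := by exact_mod_cast r.factorial_pos
  rw [← div_pow]
  constructor
  · have : (H.card : ℝ) * r.factorial ≤ (n / r : ℝ) ^ r * r.factorial := by
      rw [hcprod] at hfin hmid
      linarith
    exact le_of_mul_le_mul_right this hf
  · intro heq v hv
    have h1 : ∑ v ∈ tup r H, (1 + ∑ k, (1 - y v k / c k))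
      = ∑ v ∈ tup r H, (∏ k, c k) * ∏ k, (y v k)⁻¹ := by
      apply le_antisymm hmid
      refine hfin.trans (le_trans (le_of_eq ?_) hsumge)
      rw [hM, heq, hcprod]; ring
    exact (hpt v hv).2 ((sum_eq_sum_iff_of_le (fun v hv => (hpt v hv).1)).1 h1 v hv)

lemma card_transversals {n r : ℕ} (P : Fin n → Fin r) (m : ℕ) (H : Finset (Finset (Fin n)))
    (hP : ∀ k : Fin r, (univ.filter (fun u : Fin n => P u = k)).card = m)
    (hH : ∀ e : Finset (Fin n), e ∈ H ↔ ∀ k : Fin r, (e.filter (fun u => P u = k)).card = 1) :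
    H.card = m ^ r := by
  have h1 : (Fintype.piFinset (fun k : Fin r => univ.filter (fun u : Fin n => P u = k))).card
      = m ^ r := by
    rw [Fintype.card_piFinset]; simp [hP]
  rw [← h1]
  symm
  have hmem : ∀ t : Fin r → Fin n, t ∈ Fintype.piFinset (fun k : Fin r =>
      univ.filter (fun u : Fin n => P u = k)) ↔ ∀ k, P (t k) = k := by
    intro t; simp [Fintype.mem_piFinset]
  apply card_bij (fun t _ => univ.image t)
  · intro t ht
    rw [hmem] at ht
    rw [hH]
    intro k
    rw [card_eq_one]
    refine ⟨t k, ?_⟩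
    ext x
    simp only [mem_filter, mem_image, mem_univ, true_and, mem_singleton]
    constructor
    · rintro ⟨⟨j, rfl⟩, h⟩
      rw [ht] at h; rw [h]
    · rintro rfl
      exact ⟨⟨k, rfl⟩, ht k⟩
  · intro t ht t' ht' h
    rw [hmem] at ht ht'
    ext k : 1
    have : t k ∈ univ.image t' := by rw [← h]; exact mem_image_of_mem _ (mem_univ _)
    rw [mem_image] at this
    obtain ⟨j, _, hj⟩ := this
    have h2 := ht k
    rw [← hj, ht'] at h2
    rw [← hj, h2]
  · intro e he
    rw [hH] at he
    choose t ht using fun k => card_eq_one.1 (he k)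
    have ht' : ∀ k, t k ∈ e ∧ P (t k) = k := by
      intro k
      have : t k ∈ e.filter (fun u => P u = k) := by rw [ht]; simp
      simpa using this
    refine ⟨t, (hmem t).2 fun k => (ht' k).2, ?_⟩
    ext x
    simp only [mem_image, mem_univ, true_and]
    constructor
    · rintro ⟨k, rfl⟩; exact (ht' k).1
    · intro hx
      have : x ∈ e.filter (fun u => P u = P x) := by simp [hx]
      rw [ht, mem_singleton] at this
      exact ⟨P x, this.symm⟩

lemma eq_case_partition {n r : ℕ} (hr : 2 ≤ r) (hn : r ≤ n) {H : Finset (Finset (Fin n))}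
    (hu : ∀ e ∈ H, e.card = r) (hfree : TriangleFree H) (hne : (tup r H).Nonempty)
    (hcard : ∀ v ∈ tup r H, ∀ k : Fin r,
      ((nbh H ((pre r k).image v)).card : ℝ) = (r - k : ℝ) * (n / r)) :
    r ∣ n ∧ ∃ P : Fin n → Fin r,
          (∀ k : Fin r, (Finset.univ.filter (fun u : Fin n => P u = k)).card = n / r) ∧
          ∀ e : Finset (Fin n),
            e ∈ H ↔ ∀ k : Fin r, (e.filter (fun u => P u = k)).card = 1 := by
  have hr0 : (r : ℝ) ≠ 0 := by positivity
  have hX : ∀ v ∈ tup r H, ∀ X : Finset (Fin r), X.card < r →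
      (nbh H (X.image v)).card * r = (r - X.card) * n := by
    intro v hv X hXr
    obtain ⟨τ, hτ⟩ := exists_perm (pre r X.card) X (card_pre _ _ hXr.le)
    have h := hcard _ ((tup_perm τ).2 hv) ⟨X.card, hXr⟩
    rw [← image_image, hτ] at h
    have h2 : ((nbh H (X.image v)).card * r : ℝ) = (r - X.card) * n := by
      rw [h]; field_simp
    have h3 : ((r - X.card : ℕ) : ℝ) = r - X.card := Nat.cast_sub hXr.le
    rw [← h3] at h2
    exact_mod_cast h2
  have hV : ∀ v ∈ tup r H, ∀ i, (nbh H ((univ.erase i).image v)).card * r = n := by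
    intro v hv i
    have hc : (univ.erase i : Finset (Fin r)).card = r - 1 := by simp
    rw [hX v hv _ (by omega), hc, show r - (r - 1) = 1 by omega, one_mul]
  have hV1 : ∀ v ∈ tup r H, ∀ i, (nbh H {v i}).card * r = (r - 1) * n := by
    intro v hv i
    have := hX v hv {i} (by simp; omega)
    simpa using this
  -- complementarity
  have hcompl : ∀ v ∈ tup r H, ∀ i, nbh H ((univ.erase i).image v) = (nbh H {v i})ᶜ := by
    intro v hv i
    have hd : Disjoint (nbh H ((univ.erase i).image v)) (nbh H {v i}) := by
      apply nbh_disj hu hfree (mem_tup.1 hv)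
      rw [← image_singleton, ← image_union]
      congr 1
      ext a; simp
    apply Finset.eq_of_subset_of_card_le
    · intro x hx
      rw [mem_compl]
      exact disjoint_left.1 hd hx
    · rw [card_compl, Fintype.card_fin]
      have h1 := hV v hv i
      have h2 := hV1 v hv i
      have h3 : (nbh H ((univ.erase i).image v)).card * r + (nbh H {v i}).card * r = r * n := by
        rw [h1, h2]
        obtain ⟨s, rfl⟩ : ∃ s, r = s + 1 := ⟨r - 1, by omega⟩
        simp only [Nat.add_sub_cancel]; ring
      have h4 : (nbh H ((univ.erase i).image v)).card + (nbh H {v i}).card = n :=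
        Nat.eq_of_mul_eq_mul_right (by omega : 0 < r) (by rw [add_mul, h3, mul_comm])
      omega
  obtain ⟨v0, hv0⟩ := hne
  have hdvd : r ∣ n := by
    have := hV v0 hv0 ⟨0, by omega⟩
    exact ⟨_, by rw [mul_comm]; exact this.symm⟩
  have hVc : ∀ i, (nbh H ((univ.erase i).image v0)).card = n / r := by
    intro i
    exact (Nat.div_eq_of_eq_mul_left (by omega) (hV v0 hv0 i).symm).symm
  have hdis : ∀ i j, i ≠ j → Disjoint (nbh H ((univ.erase i).image v0))
      (nbh H ((univ.erase j).image v0)) := by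
    intro i j hij
    apply nbh_disj hu hfree (mem_tup.1 hv0)
    rw [← image_union]
    congr 1
    ext a; simp only [mem_union, mem_erase, mem_univ, and_true, iff_true]
    by_contra h; push Not at h; exact hij (h.1.symm.trans h.2)
  have hcover : univ.biUnion (fun i => nbh H ((univ.erase i).image v0)) = univ := by
    apply Finset.eq_univ_of_card
    rw [card_biUnion (fun i _ j _ h => hdis i j h)]
    simp [hVc, Nat.mul_div_cancel' hdvd]
  have hex : ∀ u : Fin n, ∃ i, u ∈ nbh H ((univ.erase i).image v0) := by
    intro u
    have : u ∈ univ.biUnion (fun i => nbh H ((univ.erase i).image v0)) := by rw [hcover]; simp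
    simpa using this
  choose P hP using hex
  have hPiff : ∀ u i, u ∈ nbh H ((univ.erase i).image v0) ↔ P u = i := by
    intro u i
    constructor
    · intro h
      by_contra hne
      exact disjoint_left.1 (hdis _ _ hne) (hP u) h
    · rintro rfl; exact hP u
  -- the invariant
  let Q : (Fin r → Fin n) → Prop := fun v =>
    v ∈ tup r H ∧ ∀ i u, u ∈ nbh H {v i} ↔ P u ≠ i
  have hQ0 : Q v0 := by
    refine ⟨hv0, fun i u => ?_⟩
    rw [ne_eq, ← hPiff, hcompl v0 hv0, mem_compl, not_not]
  have hQup : ∀ v i w, Q v → P w = i → Q (Function.update v i w) := by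
    intro v i w hv hw
    have himg : (univ.erase i).image (Function.update v i w) = (univ.erase i).image v := by
      apply image_congr
      intro j hj
      have : j ≠ i := by simpa using hj
      simp [this]
    have hall : univ.image (Function.update v i w) = insert w ((univ.erase i).image v) := by
      rw [← himg]
      conv_lhs => rw [← insert_erase (mem_univ i), image_insert]
      simp
    have hwm : w ∈ nbh H ((univ.erase i).image v) := by
      rw [hcompl v hv.1, mem_compl, hv.2]; simpa using hw
    have htup : Function.update v i w ∈ tup r H := by
      rw [mem_tup, hall]
      rw [mem_nbh] at hwm
      obtain ⟨h1, B, hB, h2⟩ := hwm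
      have : insert w ((univ.erase i).image v) = B := by
        apply Finset.eq_of_subset_of_card_le h2
        rw [hu B hB, card_insert_of_notMem h1, card_image_of_injective _ (tup_inj hu hv.1)]
        simp
        omega
      rw [this]; exact hB
    refine ⟨htup, fun j u => ?_⟩
    by_cases hj : j = i
    · subst hj
      have h1 := hcompl _ htup j
      rw [himg, hcompl v hv.1] at h1
      rw [← compl_injective h1]
      exact hv.2 j u
    · rw [Function.update_of_ne hj]; exact hv.2 j u
  have hQt : ∀ t : Fin r → Fin n, (∀ i, P (t i) = i) → Q t := by
    intro t ht
    have : ∀ s : Finset (Fin r), Q (s.piecewise t v0) := by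
      intro s
      induction s using Finset.induction_on with
      | empty => simpa using hQ0
      | insert j s _ ih =>
        rw [Finset.piecewise_insert]
        exact hQup _ _ _ ih (ht j)
    simpa using this univ
  refine ⟨hdvd, P, ?_, ?_⟩
  · intro k
    rw [← hVc k]
    congr 1
    ext u
    simp [hPiff]
  · intro e
    constructor
    · intro he
      have hle : ∀ k ∈ (univ : Finset (Fin r)), (e.filter (fun u => P u = k)).card ≤ 1 := by
        intro k _
        rw [card_le_one]
        intro a ha b hb
        rw [mem_filter] at ha hb
        by_contra hab
        have hq := hQup v0 k a hQ0 ha.2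
        have := hq.2 k b
        rw [Function.update_self] at this
        refine this.1 ?_ hb.2
        rw [mem_nbh]
        refine ⟨by simpa using Ne.symm hab, e, he, ?_⟩
        intro x hx
        simp only [mem_insert, mem_singleton] at hx
        rcases hx with rfl | rfl
        · exact hb.1
        · exact ha.1
      have hsum : ∑ k : Fin r, (e.filter (fun u => P u = k)).card = ∑ k : Fin r, 1 := by
        rw [← Finset.card_eq_sum_card_fiberwise (fun _ _ => mem_coe.2 (mem_univ _)), hu e he]
        simp
      intro k
      exact (sum_eq_sum_iff_of_le hle).1 hsum k (mem_univ _)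
    · intro he
      choose t ht using fun k => card_eq_one.1 (he k)
      have ht' : ∀ k, t k ∈ e ∧ P (t k) = k := by
        intro k
        have : t k ∈ e.filter (fun u => P u = k) := by rw [ht]; simp
        simpa using this
      have hq := mem_tup.1 (hQt t fun k => (ht' k).2).1
      have : univ.image t = e := by
        ext x
        simp only [mem_image, mem_univ, true_and]
        constructor
        · rintro ⟨k, rfl⟩; exact (ht' k).1
        · intro hx
          have : x ∈ e.filter (fun u => P u = P x) := by simp [hx]
          rw [ht, mem_singleton] at this
          exact ⟨P x, this.symm⟩
      rwa [← this]

theorem triangle_free_edge_bound (r n : ℕ) (hr : 2 ≤ r) (hn : r ≤ n)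
    (H : Finset (Finset (Fin n))) (huniform : ∀ e ∈ H, e.card = r)
    (hfree : TriangleFree H) :
    (H.card : ℝ) ≤ (n : ℝ) ^ r / (r : ℝ) ^ r ∧
      ((H.card : ℝ) = (n : ℝ) ^ r / (r : ℝ) ^ r ↔
        (r ∣ n ∧ ∃ P : Fin n → Fin r,
          (∀ k : Fin r, (Finset.univ.filter (fun u : Fin n => P u = k)).card = n / r) ∧
          ∀ e : Finset (Fin n),
            e ∈ H ↔ ∀ k : Fin r, (e.filter (fun u => P u = k)).card = 1)) := by
  have hmain := main_ineq hr hn huniform hfree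
  refine ⟨hmain.1, fun heq => ?_, ?_⟩
  · refine eq_case_partition hr hn huniform hfree ?_ (hmain.2 heq)
    rw [← card_pos, card_tup huniform]
    apply Nat.mul_pos _ r.factorial_pos
    have h1 : (0 : ℝ) < n := by
      have : 0 < n := by omega
      exact_mod_cast this
    have h2 : (0 : ℝ) < r := by
      have : 0 < r := by omega
      exact_mod_cast this
    have : (0 : ℝ) < H.card := by rw [heq]; positivity
    exact_mod_cast this
  · rintro ⟨hd, P, hP, hH⟩
    rw [card_transversals P (n / r) H hP hH, Nat.cast_pow, Nat.cast_div hd, div_pow]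
    have : r ≠ 0 := by omega
    exact_mod_cast this
end
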